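/- arXiv:1110.1507 — 2 statements merged into one kernel-verified Lean document; each statement's English description precedes it below -/
import Mathlib

section
/- Let N ⊆ Ω be a connected open set, σ: t ↦ Σ_t (t ∈ [0,1]) a smooth path lying in N, and f a twice-differentiable function on N. Then the function t ↦ ∇_{Dσ(t)} f(Σ_t) is continuous on [0,1] and ∫₀¹ ∇_{Dσ(t)} f(Σ_t) dt = f(Σ₁) − f(Σ₀). -/
open Set Filter Topology

noncomputable section

attribute [local instance] Classical.propDecidable

/-- The Riemann sphere, modelled as the one-point compactification of `ℂ`. -/
abbrev RS := OnePoint ℂ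

namespace CFT

/-- Read a point of the sphere in the standard (finite) coordinate; `∞ ↦ 0` (junk). -/
def toC (p : RS) : ℂ := Option.rec 0 id (show Option ℂ from p)

/-- The chart at infinity: `z ↦ 1/z`, with `0 ↦ ∞`. -/
def fromInvChart (z : ℂ) : RS := if z = 0 then OnePoint.infty else ((z⁻¹ : ℂ) : RS)

/-- Read a point of the sphere in the coordinate at infinity. -/
def toInvChart (q : RS) : ℂ := if q = OnePoint.infty then 0 else (toC q)⁻¹

/-- Holomorphy of a sphere map at a point, read in the standard charts. -/
def SphHolAt (f : RS → RS) (p : RS) : Prop :=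
  ContinuousAt f p ∧
  AnalyticAt ℂ
    (fun z : ℂ =>
      (if f p = OnePoint.infty then toInvChart else toC)
        (f (if p = OnePoint.infty then fromInvChart z else ((z : ℂ) : RS))))
    (if p = OnePoint.infty then 0 else toC p)

/-- A conformal map: a holomorphic injection defined on a domain of the Riemann sphere. -/
structure ConfMap where
  dom : Set RS
  toFun : RS → RS
  isOpen_dom : IsOpen dom
  nonempty_dom : dom.Nonempty
  dom_ne_univ : dom ≠ univ
  holo : ∀ p ∈ dom, SphHolAt toFun p
  injOn : InjOn toFun dom

/-- A domain: a nonempty open proper subset of the Riemann sphere. -/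
def IsDomain (A : Set RS) : Prop := IsOpen A ∧ A.Nonempty ∧ A ≠ univ

/-- The round (chordal) metric on the sphere, normalized so that `d(0,∞) = 1`. -/
def chord (p q : RS) : ℝ :=
  Option.rec
    (Option.rec 0 (fun w => 1 / Real.sqrt (1 + ‖w‖ ^ 2)) (show Option ℂ from q))
    (fun z =>
      Option.rec (1 / Real.sqrt (1 + ‖z‖ ^ 2))
        (fun w => ‖z - w‖ / (Real.sqrt (1 + ‖z‖ ^ 2) * Real.sqrt (1 + ‖w‖ ^ 2)))
        (show Option ℂ from q))
    (show Option ℂ from p)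

/-- The connected component of `0` in the complement of `S`. -/
def intComp (S : Set RS) : Set RS := connectedComponentIn Sᶜ ((0 : ℂ) : RS)

/-- The connected component of `∞` in the complement of `S`. -/
def extComp (S : Set RS) : Set RS := connectedComponentIn Sᶜ OnePoint.infty

/-- `α(Σ)`: the set together with the component of its complement containing `0`. -/
def alphaSetOf (S : Set RS) : Set RS := S ∪ intComp S

/-- `β(Σ)`: the set together with the component of its complement containing `∞`. -/
def betaSetOf (S : Set RS) : Set RS := S ∪ extComp S

/-- Sense-preservation of a conformal map relative to an annular continuum `S`. -/
def SensePreserving (g : ConfMap) (S : Set RS) : Prop :=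
  ((0 : ℂ) : RS) ∉ g.toFun '' S ∧ OnePoint.infty ∉ g.toFun '' S ∧
  intComp (g.toFun '' S) ≠ extComp (g.toFun '' S) ∧
  g.toFun '' (g.dom ∩ intComp S) ⊆ intComp (g.toFun '' S) ∧
  g.toFun '' (g.dom ∩ extComp S) ⊆ extComp (g.toFun '' S)

/-- An annular continuum separating `0` from `∞`, with both complementary components
simply connected. -/
structure IsAnnular (S : Set RS) : Prop where
  compact : IsCompact S
  connected : IsConnected S
  zero_not_mem : ((0 : ℂ) : RS) ∉ S
  infty_not_mem : OnePoint.infty ∉ S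
  comps : ∀ p ∉ S, connectedComponentIn Sᶜ p = intComp S ∨ connectedComponentIn Sᶜ p = extComp S
  comps_ne : intComp S ≠ extComp S
  simply_int : SimplyConnectedSpace ↥(intComp S)
  simply_ext : SimplyConnectedSpace ↥(extComp S)

/-- `g` is defined and sense-preserving on `S` (so it "has an action" there). -/
def HasActionOn (g : ConfMap) (S : Set RS) : Prop := S ⊆ g.dom ∧ SensePreserving g S

/-- An exhaustion of a domain by an increasing sequence of compact sets. -/
structure Exhaustion (A : Set RS) where
  D : ℕ → Set RS
  isCompact : ∀ n, IsCompact (D n)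
  mono : Monotone D
  iUnion_eq : (⋃ n, D n) = A

/-- The functional `δ_A(g)` measuring distance of a conformal map from the identity,
relative to an exhaustion of `A`. -/
def deltaA {A : Set RS} (e : Exhaustion A) (g : ConfMap) : ℝ :=
  ∑' n : ℕ, (2 : ℝ)⁻¹ ^ (n + 1) *
    (if e.D n ⊆ g.dom then sSup ((fun z => chord (g.toFun z) z) '' e.D n) else 1)

/-- A global choice of exhaustions, one for each domain. -/
abbrev ExhChoice := ∀ A : Set RS, IsDomain A → Exhaustion A

/-- The set of complex points of `A`, in the global coordinate. -/
def finitePart (A : Set RS) : Set ℂ := {z : ℂ | (z : RS) ∈ A}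

/-- Holomorphic vector fields on a domain `A`, written in the global coordinate
(with the order-two condition at `∞` when `∞ ∈ A`). -/
def HVFset (A : Set RS) : Set (ℂ → ℂ) :=
  {h | DifferentiableOn ℂ h (finitePart A) ∧
    (OnePoint.infty ∈ A → ∃ H : ℂ → ℂ, AnalyticAt ℂ H 0 ∧
      ∀ᶠ w in 𝓝[≠] (0 : ℂ), H w = w ^ 2 * h w⁻¹)}

/-- Compact convergence (in local coordinates) of vector fields on a domain `A`. -/
def HVFTendsto {ι : Type*} (A : Set RS) (l : Filter ι) (hs : ι → ℂ → ℂ) (h : ℂ → ℂ) : Prop :=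
  TendstoLocallyUniformlyOn hs h l (finitePart A) ∧
  (OnePoint.infty ∈ A →
    TendstoLocallyUniformlyOn (fun i w => w ^ 2 * hs i w⁻¹) (fun w => w ^ 2 * h w⁻¹) l
      {w : ℂ | w ≠ 0 ∧ ((w⁻¹ : ℂ) : RS) ∈ A})

/-- The vector fields `h_{n;w}(z) = (w-z)^{n+1}`. -/
def hvf (n : ℤ) (w : ℂ) : ℂ → ℂ := fun z => (w - z) ^ (n + 1)

/-- A conformal map read in the global coordinate. -/
def mapC (g : ConfMap) : ℂ → ℂ := fun z => toC (g.toFun (z : RS))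

/-- The derivative `∂g(w)` of a conformal map at a finite point. -/
def dg (g : ConfMap) (w : ℂ) : ℂ := deriv (mapC g) w

/-- The Schwarzian derivative `{g, w}`. -/
def schwarzian (g : ConfMap) (w : ℂ) : ℂ :=
  iteratedDeriv 3 (mapC g) w / deriv (mapC g) w -
    (3 / 2) * (iteratedDeriv 2 (mapC g) w / deriv (mapC g) w) ^ 2

/-- Joint continuity and real multilinearity of a functional on `k`-tuples of holomorphic
vector fields on `A` (continuity in the compact convergence topology). -/
def IsContMultilinear (A : Set RS) (k : ℕ) (L : (Fin k → ℂ → ℂ) → ℂ) : Prop :=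
  (∀ (v : Fin k → ℂ → ℂ) (j : Fin k) (h' : ℂ → ℂ), (∀ i, v i ∈ HVFset A) → h' ∈ HVFset A →
    L (Function.update v j (v j + h')) = L v + L (Function.update v j h')) ∧
  (∀ (v : Fin k → ℂ → ℂ) (j : Fin k) (c : ℝ), (∀ i, v i ∈ HVFset A) →
    L (Function.update v j (c • v j)) = c • L v) ∧
  (∀ (vs : ℕ → Fin k → ℂ → ℂ) (v : Fin k → ℂ → ℂ),
    (∀ n i, vs n i ∈ HVFset A) → (∀ i, v i ∈ HVFset A) →
    (∀ i, HVFTendsto A atTop (fun n => vs n i) (v i)) →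
    Tendsto (fun n => L (vs n)) atTop (𝓝 (L v)))

/-- Admissible `k`-parameter families of conformal maps tending to the identity
in the `A`-topology, with directions `h j` (the set `F^k(A)` of the paper). -/
def FamilyOK (X : ExhChoice) {A : Set RS} (hA : IsDomain A) {k : ℕ}
    (g : (Fin k → ℝ) → Fin k → ConfMap) (h : Fin k → ℂ → ℂ) : Prop :=
  (∀ j, Tendsto (fun t => deltaA (X A hA) (g t j)) (𝓝 0) (𝓝 0)) ∧
  (∀ j, TendstoLocallyUniformlyOn
      (fun (t : Fin k → ℝ) (z : ℂ) => (t j)⁻¹ • (toC ((g t j).toFun (z : RS)) - z)) (h j)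
      (𝓝[{t | t j ≠ 0}] 0) (finitePart A))

section OmegaSection

variable (E : Set RS)

/-- The space `Ω`: restrictions to `E` of sense-preserving conformal maps defined
on neighbourhoods of `E` (two maps being identified when they agree on `E`). -/
def OmegaS : Set (E → RS) :=
  {φ | ∃ g : ConfMap, E ⊆ g.dom ∧ SensePreserving g E ∧ ∀ x : E, φ x = g.toFun ↑x}

/-- Action of a conformal map on an element of `Ω`: `g·Σ := g ∘ Σ`. -/
def actF (g : ConfMap) (φ : E → RS) : E → RS := fun x => g.toFun (φ x)

/-- Open sets of the conformal topology on `Ω`. -/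
def ConfOpen (X : ExhChoice) (N : Set (E → RS)) : Prop :=
  N ⊆ OmegaS E ∧
  ∀ φ ∈ N, ∀ A : Set RS, ∀ hA : IsDomain A, range φ ⊆ A →
    ∃ r : ℝ, 0 < r ∧ r < 1 ∧ ∀ g : ConfMap, deltaA (X A hA) g < r → actF E g φ ∈ N

/-- An α-map at `Σ`: a sense-preserving conformal map on a simply connected domain
containing `α(Σ)`, having an action on `Σ`. -/
def IsAlphaMap (g : ConfMap) (φ : E → RS) : Prop :=
  IsDomain g.dom ∧ SimplyConnectedSpace ↥g.dom ∧ alphaSetOf (range φ) ⊆ g.dom ∧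
  HasActionOn g (range φ)

/-- A β-map at `Σ`. -/
def IsBetaMap (g : ConfMap) (φ : E → RS) : Prop :=
  IsDomain g.dom ∧ SimplyConnectedSpace ↥g.dom ∧ betaSetOf (range φ) ⊆ g.dom ∧
  HasActionOn g (range φ)

/-- Continuity at a point of a map into `Ω`, with respect to the conformal topology. -/
def ContinuousAtOmega (X : ExhChoice) {M : Type*} [TopologicalSpace M]
    (σ : M → E → RS) (p : M) : Prop :=
  ∀ N : Set (E → RS), ConfOpen E X N → σ p ∈ N → ∀ᶠ t in 𝓝 p, σ t ∈ N

/-- The data for differentiability of a path at `p`: the maps `G t = Σ_t ∘ Σ_p⁻¹`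
converge to the identity in the `A`-topology and the difference quotients converge
compactly on `A` to the direction `h`. -/
def DiffQuotOK (X : ExhChoice) (A : Set RS) (hA : IsDomain A) (σ : ℝ → E → RS) (p : ℝ)
    (G : ℝ → ConfMap) (h : ℂ → ℂ) : Prop :=
  (∀ t, ∀ x : E, (G t).toFun (σ p x) = σ t x) ∧
  Tendsto (fun t => deltaA (X A hA) (G t)) (𝓝 p) (𝓝 0) ∧
  TendstoLocallyUniformlyOn
    (fun t (z : ℂ) => (t - p)⁻¹ • (toC ((G t).toFun (z : RS)) - z)) h
    (𝓝[≠] p) (finitePart A)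

/-- Differentiability of a path in `Ω` at `p`, with direction `h ∈ H^>(A)`. -/
def PathDiffAt (X : ExhChoice) (σ : ℝ → E → RS) (p : ℝ) (A : Set RS) (hA : IsDomain A)
    (h : ℂ → ℂ) : Prop :=
  ContinuousAtOmega E X σ p ∧ range (σ p) ⊆ A ∧ h ∈ HVFset A ∧
  ∃ G : ℝ → ConfMap, DiffQuotOK E X A hA σ p G h

/-- The data of a smooth path on `[u,v]`: differentiable at every point with
continuously varying direction `Dir`. -/
def SmoothPathData (X : ExhChoice) (σ : ℝ → E → RS) (u v : ℝ) (B : Set RS) (hB : IsDomain B)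
    (Dir : ℝ → ℂ → ℂ) : Prop :=
  (∀ t ∈ Icc u v, PathDiffAt E X σ t B hB (Dir t)) ∧
  (∀ t ∈ Icc u v, HVFTendsto B (𝓝 t) Dir (Dir t))

/-- A smooth path on `[u,v]`. -/
def IsSmoothPathOn (X : ExhChoice) (σ : ℝ → E → RS) (u v : ℝ) : Prop :=
  ∃ B hB Dir, SmoothPathData E X σ u v B hB Dir

/-- A smooth α-path. -/
def IsSmoothAlphaPathOn (X : ExhChoice) (σ : ℝ → E → RS) (u v : ℝ) : Prop :=
  ∃ B hB Dir, SmoothPathData E X σ u v B hB Dir ∧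
    ∀ t ∈ Icc u v, alphaSetOf (range (σ t)) ⊆ B

/-- A smooth β-path. -/
def IsSmoothBetaPathOn (X : ExhChoice) (σ : ℝ → E → RS) (u v : ℝ) : Prop :=
  ∃ B hB Dir, SmoothPathData E X σ u v B hB Dir ∧
    ∀ t ∈ Icc u v, betaSetOf (range (σ t)) ⊆ B

/-- A piecewise smooth path on `[u,v]` (a finite concatenation of smooth paths). -/
def IsPiecewiseSmoothPathOn (X : ExhChoice) (σ : ℝ → E → RS) (u v : ℝ) : Prop :=
  ∃ (n : ℕ) (ts : ℕ → ℝ), ts 0 = u ∧ ts n = v ∧ (∀ i < n, ts i ≤ ts (i + 1)) ∧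
    ∀ i < n, IsSmoothPathOn E X σ (ts i) (ts (i + 1))

/-- A piecewise smooth α-path. -/
def IsPiecewiseSmoothAlphaPathOn (X : ExhChoice) (σ : ℝ → E → RS) (u v : ℝ) : Prop :=
  ∃ (n : ℕ) (ts : ℕ → ℝ), ts 0 = u ∧ ts n = v ∧ (∀ i < n, ts i ≤ ts (i + 1)) ∧
    ∀ i < n, IsSmoothAlphaPathOn E X σ (ts i) (ts (i + 1))

/-- A piecewise smooth β-path. -/
def IsPiecewiseSmoothBetaPathOn (X : ExhChoice) (σ : ℝ → E → RS) (u v : ℝ) : Prop :=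
  ∃ (n : ℕ) (ts : ℕ → ℝ), ts 0 = u ∧ ts n = v ∧ (∀ i < n, ts i ≤ ts (i + 1)) ∧
    ∀ i < n, IsSmoothBetaPathOn E X σ (ts i) (ts (i + 1))

/-- Piecewise α-smooth connectedness of a subset of `Ω`. -/
def PiecewiseAlphaConnected (X : ExhChoice) (N : Set (E → RS)) : Prop :=
  ∀ φ ∈ N, ∀ g : ConfMap, IsAlphaMap E g φ → actF E g φ ∈ N →
    ∃ σ : ℝ → E → RS, σ 0 = φ ∧ σ 1 = actF E g φ ∧ (∀ t ∈ Icc (0 : ℝ) 1, σ t ∈ N) ∧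
      IsPiecewiseSmoothAlphaPathOn E X σ 0 1

/-- Piecewise β-smooth connectedness of a subset of `Ω`. -/
def PiecewiseBetaConnected (X : ExhChoice) (N : Set (E → RS)) : Prop :=
  ∀ φ ∈ N, ∀ g : ConfMap, IsBetaMap E g φ → actF E g φ ∈ N →
    ∃ σ : ℝ → E → RS, σ 0 = φ ∧ σ 1 = actF E g φ ∧ (∀ t ∈ Icc (0 : ℝ) 1, σ t ∈ N) ∧
      IsPiecewiseSmoothBetaPathOn E X σ 0 1

/-- Piecewise smooth connectedness of a subset of `Ω`. -/
def PiecewiseSmoothlyConnected (X : ExhChoice) (N : Set (E → RS)) : Prop :=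
  ∀ φ ∈ N, ∀ ψ ∈ N,
    ∃ σ : ℝ → E → RS, σ 0 = φ ∧ σ 1 = ψ ∧ (∀ t ∈ Icc (0 : ℝ) 1, σ t ∈ N) ∧
      IsPiecewiseSmoothPathOn E X σ 0 1

/-- `g_S · Σ`: composition of the family maps over the subset `S` (increasing indices
outermost first, i.e. `g_S = g^{(j₁)} ∘ ⋯ ∘ g^{(j_{|S|})}` with `j₁ < ⋯ < j_{|S|}`). -/
def applyFam {k : ℕ} (g : (Fin k → ℝ) → Fin k → ConfMap) (t : Fin k → ℝ) (S : Finset (Fin k))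
    (φ : E → RS) : E → RS :=
  fun x => (S.sort (· ≤ ·)).foldr (fun j q => (g t j).toFun q) (φ x)

/-- `f` has `k`-th `A`-differential `L` at `Σ`: the alternating-sum multi-difference
limits exist along all admissible families and are given by the continuous real
multilinear functional `L` (the direction of `g^{(j)}` sits in slot `j`,
slot `0` being the innermost derivative). -/
def HasKDeriv (X : ExhChoice) (f : (E → RS) → ℂ) (φ : E → RS) (A : Set RS) (hA : IsDomain A)
    (k : ℕ) (L : (Fin k → ℂ → ℂ) → ℂ) : Prop :=
  IsContMultilinear A k L ∧
  ∀ (g : (Fin k → ℝ) → Fin k → ConfMap) (h : Fin k → ℂ → ℂ),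
    (∀ j, h j ∈ HVFset A) → FamilyOK X hA g h →
    Tendsto (fun t : Fin k → ℝ =>
        (∏ j, t j)⁻¹ • ∑ S : Finset (Fin k), (-1 : ℂ) ^ (k - S.card) * f (applyFam E g t S φ))
      (𝓝[{t | ∀ j, t j ≠ 0}] 0) (𝓝 (L h))

/-- `k` times `A`-differentiability at `Σ` (with the recursive neighbourhood condition). -/
def KDiffAtA (X : ExhChoice) (f : (E → RS) → ℂ) :
    ℕ → (E → RS) → ∀ A : Set RS, IsDomain A → Prop
  | 0, _, _, _ => True
  | (k + 1), φ, A, hA =>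
      (∃ L, HasKDeriv E X f φ A hA (k + 1) L) ∧
      (1 ≤ k → ∃ M : Set (E → RS), ConfOpen E X M ∧ φ ∈ M ∧
        (∀ ψ ∈ M, range ψ ⊆ A) ∧ ∀ ψ ∈ M, KDiffAtA X f k ψ A hA)

/-- `k` times differentiability at `Σ` (for every domain containing `γ(Σ)`). -/
def KTimesDiffAt (X : ExhChoice) (f : (E → RS) → ℂ) (k : ℕ) (φ : E → RS) : Prop :=
  ∀ (A : Set RS) (hA : IsDomain A), range φ ⊆ A → KDiffAtA E X f k φ A hA

/-- Differentiability at `Σ`. -/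
def DiffAt (X : ExhChoice) (f : (E → RS) → ℂ) (φ : E → RS) : Prop :=
  KTimesDiffAt E X f 1 φ

/-- Smoothness on a set. -/
def SmoothOn (X : ExhChoice) (N : Set (E → RS)) (f : (E → RS) → ℂ) : Prop :=
  ∀ φ ∈ N, ∀ k : ℕ, KTimesDiffAt E X f k φ

/-- Iterated application of a derivative operator `D` (slot `0` innermost). -/
def iterD (D : (ℂ → ℂ) → ((E → RS) → ℂ) → (E → RS) → ℂ) :
    ∀ k : ℕ, (Fin k → ℂ → ℂ) → ((E → RS) → ℂ) → (E → RS) → ℂ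
  | 0, _, f => f
  | (k + 1), v, f => D (v (Fin.last k)) (fun ψ => iterD D k (fun i => v i.castSucc) f ψ)

/-- `D` is a conformal derivative operator: wherever a function has a `k`-th
differential, iterated applications of `D` compute it. -/
def IsNablaOp (X : ExhChoice) (D : (ℂ → ℂ) → ((E → RS) → ℂ) → (E → RS) → ℂ) : Prop :=
  ∀ (f : (E → RS) → ℂ) (φ : E → RS) (A : Set RS) (hA : IsDomain A) (k : ℕ)
    (L : (Fin k → ℂ → ℂ) → ℂ) (v : Fin k → ℂ → ℂ),
    0 < k → (∀ i, v i ∈ HVFset A) → HasKDeriv E X f φ A hA k L →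
    iterD E D k v f φ = L v

/-- The holomorphic derivative `Δ[h] = (∇_h - i ∇_{ih})/2`. -/
def Dh (D : (ℂ → ℂ) → ((E → RS) → ℂ) → (E → RS) → ℂ) (h : ℂ → ℂ) (f : (E → RS) → ℂ) :
    (E → RS) → ℂ :=
  fun φ => (1 / 2 : ℂ) * (D h f φ - Complex.I * D (fun z => Complex.I * h z) f φ)

/-- The structure polynomials `k_ℓ(w)` of a conformal Gaussian. -/
def kpoly (d₁ d₂ d₃ : ℂ) (ℓ : ℤ) (w : ℂ) : ℂ :=
  if ℓ = -2 then d₁ * w ^ 2 + d₂ * w + d₃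
  else if ℓ = -3 then -2 * d₁ * w - d₂
  else if ℓ = -4 then d₁ else 0

/-- The structure constants `(n-m) k_{n+m}(w) + (c/12)(n³-n) δ_{n+m,0}`. -/
def structConst (c d₁ d₂ d₃ : ℂ) (n m : ℤ) (w : ℂ) : ℂ :=
  ((n : ℂ) - (m : ℂ)) * kpoly d₁ d₂ d₃ (n + m) w +
    (c / 12) * ((n : ℂ) ^ 3 - (n : ℂ)) * (if n + m = 0 then 1 else 0)

/-- The equation `Δ[h_{n;w}] Δ[h_{m;w}] log Z (Σ) = K` (order according to the sign of
`n+m`), interpreted at zeros of `Z` after multiplying through by `Z(Σ)²`. -/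
def Gauss2Eq (D : (ℂ → ℂ) → ((E → RS) → ℂ) → (E → RS) → ℂ) (Z : (E → RS) → ℂ)
    (n m : ℤ) (w : ℂ) (φ : E → RS) (K : ℂ) : Prop :=
  if -1 ≤ n + m then
    Z φ * Dh E D (hvf n w) (Dh E D (hvf m w) Z) φ -
      Dh E D (hvf n w) Z φ * Dh E D (hvf m w) Z φ = K * Z φ ^ 2
  else
    Z φ * Dh E D (hvf m w) (Dh E D (hvf n w) Z) φ -
      Dh E D (hvf m w) Z φ * Dh E D (hvf n w) Z φ = K * Z φ ^ 2

/-- A conformal Gaussian on an open set `N`: a smooth function whose ordered second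
logarithmic derivatives at some base point `v` are independent of `Σ` on `N`. -/
def IsConfGaussian (X : ExhChoice) (D : (ℂ → ℂ) → ((E → RS) → ℂ) → (E → RS) → ℂ)
    (N : Set (E → RS)) (Z : (E → RS) → ℂ) : Prop :=
  SmoothOn E X N Z ∧
  ∃ v : ℂ, (∀ φ ∈ N, ((v : ℂ) : RS) ∉ betaSetOf (range φ)) ∧
    ∀ n m : ℤ, -1 ≤ n → m ≤ -2 → ∃ K : ℂ, ∀ φ ∈ N, Gauss2Eq E D Z n m v φ K

/-- `Z` has the conformal-Gaussian structure with exponent `c` and anomaly `(d₁,d₂,d₃)`. -/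
def HasGaussStructure (D : (ℂ → ℂ) → ((E → RS) → ℂ) → (E → RS) → ℂ)
    (N : Set (E → RS)) (Z : (E → RS) → ℂ) (c d₁ d₂ d₃ : ℂ) : Prop :=
  ∀ φ ∈ N, ∀ w : ℂ, ((w : ℂ) : RS) ∉ betaSetOf (range φ) →
    ∀ n m : ℤ, -1 ≤ n → m ≤ -2 → Gauss2Eq E D Z n m w φ (structConst c d₁ d₂ d₃ n m w)

/-- α-holomorphicity of `f` at `Σ`: all antiholomorphic derivatives along vector fields
holomorphic on domains containing `α(Σ)` vanish. -/
def AlphaHolomorphicAt (D : (ℂ → ℂ) → ((E → RS) → ℂ) → (E → RS) → ℂ)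
    (f : (E → RS) → ℂ) (φ : E → RS) : Prop :=
  ∀ A : Set RS, IsDomain A → alphaSetOf (range φ) ⊆ A →
    ∀ h ∈ HVFset A, D h f φ + Complex.I * D (fun z => Complex.I * h z) f φ = 0

/-- Property H: `Δ[h_{-2;w}] log Z` is α-holomorphic at every `Σ ∈ N`, for every
`w ∈ ℂ∖β(Σ)`. -/
def PropertyH (D : (ℂ → ℂ) → ((E → RS) → ℂ) → (E → RS) → ℂ)
    (Z : (E → RS) → ℂ) (N : Set (E → RS)) : Prop :=
  ∀ φ ∈ N, ∀ w : ℂ, ((w : ℂ) : RS) ∉ betaSetOf (range φ) →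
    AlphaHolomorphicAt E D (fun ψ => Dh E D (hvf (-2) w) Z ψ / Z ψ) φ

end OmegaSection

end CFT

namespace CFT

theorem sum_finset_fin_one (F : Finset (Fin 1) → ℂ) :
    ∑ S, F S = F ∅ + F {0} := by
  have h : (Finset.univ : Finset (Finset (Fin 1))).val = {∅, {0}} := rfl
  rw [Finset.sum, h]
  simp

theorem sum_finset_fin_two (F : Finset (Fin 2) → ℂ) :
    ∑ S, F S = F ∅ + F {0} + F {1} + F Finset.univ := by
  have h : (Finset.univ : Finset (Finset (Fin 2))).val = {∅, {0}, {1}, Finset.univ} := rfl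
  rw [Finset.sum, h]
  simp [add_assoc]

theorem sort_univ_fin_two :
    (Finset.univ : Finset (Fin 2)).sort (· ≤ ·) = [0, 1] := by
  refine List.Perm.eq_of_pairwise' (r := (· ≤ ·)) (Finset.pairwise_sort _ _) (by simp) ?_
  rw [List.perm_ext_iff_of_nodup (Finset.sort_nodup _ _) (by simp)]
  intro a
  fin_cases a <;> simp

/-- A property holding eventually along an injective null sequence and along a family holds eventually
along the family modified on that sequence. -/
theorem eventually_extend {α : Type*} {ε : ℕ → ℝ} (hinj : Function.Injective ε)
    (hne : ∀ n, ε n ≠ 0) {l : Filter ℝ} (hl : l ≤ 𝓝 0) {H : ℕ → α} {G : ℝ → α}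
    {Q : α → ℝ → Prop} (hH : ∀ᶠ n in atTop, Q (H n) (ε n)) (hG : ∀ᶠ x in l, Q (G x) x) :
    ∀ᶠ x in l, Q (Function.extend ε H G x) x := by
  obtain ⟨m, hm⟩ := eventually_atTop.1 hH
  have hfin : (ε '' Iio m)ᶜ ∈ 𝓝 (0 : ℝ) := by
    refine ((finite_Iio m).image ε).isClosed.isOpen_compl.mem_nhds ?_
    rintro ⟨n, -, hn⟩
    exact hne n hn
  filter_upwards [hG, hl hfin] with x hx hx'
  by_cases h : ∃ n, ε n = x
  · obtain ⟨n, rfl⟩ := h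
    rw [hinj.extend_apply]
    refine hm n ?_
    by_contra hlt
    exact hx' ⟨n, not_le.1 hlt, rfl⟩
  · rwa [Function.extend_apply' _ _ _ h]

/-- One-parameter families of maps tending to the identity with direction `h`. -/
def FamilyTo (X : ExhChoice) {A : Set RS} (hA : IsDomain A) (k : ℝ → ConfMap)
    (h : ℂ → ℂ) : Prop :=
  Tendsto (fun x => deltaA (X A hA) (k x)) (𝓝 0) (𝓝 0) ∧
  TendstoLocallyUniformlyOn
    (fun (x : ℝ) (z : ℂ) => x⁻¹ • (toC ((k x).toFun (z : RS)) - z)) h (𝓝[≠] 0) (finitePart A)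

theorem FamilyTo.extend {X : ExhChoice} {A : Set RS} {hA : IsDomain A} {k : ℝ → ConfMap}
    {h : ℂ → ℂ} (hk : FamilyTo X hA k h) {ε : ℕ → ℝ} (hinj : Function.Injective ε)
    (hne : ∀ n, ε n ≠ 0) {H : ℕ → ConfMap}
    (hδ : Tendsto (fun n => deltaA (X A hA) (H n)) atTop (𝓝 0))
    (hH : TendstoLocallyUniformlyOn
      (fun n (z : ℂ) => (ε n)⁻¹ • (toC ((H n).toFun (z : RS)) - z)) h atTop (finitePart A)) :
    FamilyTo X hA (Function.extend ε H k) h := by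
  constructor
  · intro U hU
    exact eventually_extend (Q := fun g _ => deltaA (X A hA) g ∈ U) hinj hne le_rfl
      (hδ hU) (hk.1 hU)
  · intro u hu z hz
    obtain ⟨t₁, ht₁, h₁⟩ := hH u hu z hz
    obtain ⟨t₂, ht₂, h₂⟩ := hk.2 u hu z hz
    refine ⟨t₁ ∩ t₂, inter_mem ht₁ ht₂, ?_⟩
    exact eventually_extend
      (Q := fun (g : ConfMap) (x : ℝ) => ∀ y ∈ t₁ ∩ t₂, (h y, x⁻¹ • (toC (g.toFun (y : RS)) - y)) ∈ u)
      hinj hne nhdsWithin_le_nhds (h₁.mono fun n hn y hy => hn y hy.1)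
      (h₂.mono fun n hn y hy => hn y hy.2)

theorem familyOK_of_familyTo {X : ExhChoice} {A : Set RS} {hA : IsDomain A} {m : ℕ}
    {k : Fin m → ℝ → ConfMap} {h : Fin m → ℂ → ℂ} (hk : ∀ j, FamilyTo X hA (k j) (h j)) :
    FamilyOK X hA (fun t j => k j (t j)) h := by
  have hev (j : Fin m) : Tendsto (fun t : Fin m → ℝ => t j) (𝓝 0) (𝓝 0) :=
    (continuous_apply j).tendsto 0
  refine ⟨fun j => (hk j).1.comp (hev j), fun j u hu z hz => ?_⟩
  obtain ⟨s, hs, H⟩ := (hk j).2 u hu z hz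
  refine ⟨s, hs, Tendsto.eventually (f := fun t : Fin m → ℝ => t j) ?_ H⟩
  exact tendsto_nhdsWithin_iff.2
    ⟨(hev j).mono_left nhdsWithin_le_nhds, eventually_mem_nhdsWithin⟩

section Differentials

variable {E : Set RS} {X : ExhChoice} {A : Set RS} {hA : IsDomain A}

theorem applyFam_empty {m : ℕ} (g : (Fin m → ℝ) → Fin m → ConfMap) (t : Fin m → ℝ)
    (φ : E → RS) : applyFam E g t ∅ φ = φ := by
  funext x
  simp [applyFam]

theorem applyFam_singleton {m : ℕ} (g : (Fin m → ℝ) → Fin m → ConfMap) (t : Fin m → ℝ)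
    (j : Fin m) (φ : E → RS) : applyFam E g t {j} φ = actF E (g t j) φ := by
  funext x
  simp [applyFam, actF]

theorem applyFam_univ_fin_two (g : (Fin 2 → ℝ) → Fin 2 → ConfMap) (t : Fin 2 → ℝ)
    (φ : E → RS) :
    applyFam E g t Finset.univ φ = actF E (g t 0) (actF E (g t 1) φ) := by
  funext x
  rw [applyFam, sort_univ_fin_two]
  rfl

theorem DiffQuotOK.familyTo {σ : ℝ → E → RS} {p : ℝ} {G : ℝ → ConfMap} {h : ℂ → ℂ}
    (hG : DiffQuotOK E X A hA σ p G h) : FamilyTo X hA (fun x => G (p + x)) h := by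
  have hp : Tendsto (fun x : ℝ => p + x) (𝓝 0) (𝓝 p) := by
    simpa using (continuous_const_add p).tendsto 0
  have hp' : Tendsto (fun x : ℝ => p + x) (𝓝[≠] 0) (𝓝[≠] p) :=
    tendsto_nhdsWithin_iff.2 ⟨hp.mono_left nhdsWithin_le_nhds, by
      filter_upwards [self_mem_nhdsWithin] with x hx
      simpa using hx⟩
  refine ⟨hG.2.1.comp hp, fun u hu z hz => ?_⟩
  obtain ⟨s, hs, H⟩ := hG.2.2 u hu z hz
  refine ⟨s, hs, (hp'.eventually H).mono fun x hx y hy => ?_⟩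
  simpa using hx y hy

theorem HasKDeriv.tendsto_one {f : (E → RS) → ℂ} {φ : E → RS}
    {L : (Fin 1 → ℂ → ℂ) → ℂ} (hL : HasKDeriv E X f φ A hA 1 L) {k : ℝ → ConfMap}
    {h : ℂ → ℂ} (hh : h ∈ HVFset A) (hk : FamilyTo X hA k h) :
    Tendsto (fun x : ℝ => x⁻¹ • (f (actF E (k x) φ) - f φ)) (𝓝[≠] 0)
      (𝓝 (L fun _ => h)) := by
  have hlim := hL.2 _ _ (fun _ => hh) (familyOK_of_familyTo (k := fun _ => k) fun _ => hk)
  have hc : Tendsto (fun (x : ℝ) (_ : Fin 1) => x) (𝓝[≠] 0)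
      (𝓝[{t : Fin 1 → ℝ | ∀ j, t j ≠ 0}] 0) :=
    tendsto_nhdsWithin_iff.2
      ⟨(tendsto_pi_nhds.2 fun _ => tendsto_id).mono_left nhdsWithin_le_nhds, by
        filter_upwards [self_mem_nhdsWithin] with x hx j
        exact hx⟩
  refine (hlim.comp hc).congr fun x => ?_
  simp only [Function.comp_apply, sum_finset_fin_one]
  rw [applyFam_empty, applyFam_singleton]
  simp [sub_eq_neg_add]

theorem HasKDeriv.tendsto_two {f : (E → RS) → ℂ} {φ : E → RS}
    {L : (Fin 2 → ℂ → ℂ) → ℂ} (hL : HasKDeriv E X f φ A hA 2 L) {k k' : ℝ → ConfMap}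
    {h : ℂ → ℂ} (hh : h ∈ HVFset A) (hk : FamilyTo X hA k h) (hk' : FamilyTo X hA k' h) :
    Tendsto (fun x : ℝ × ℝ => (x.1 * x.2)⁻¹ •
        (f (actF E (k x.1) (actF E (k' x.2) φ)) - f (actF E (k x.1) φ) -
          f (actF E (k' x.2) φ) + f φ)) (𝓝[≠] 0 ×ˢ 𝓝[≠] 0)
      (𝓝 (L fun _ => h)) := by
  have hlim := hL.2 _ _ (fun _ => hh)
    (familyOK_of_familyTo (k := ![k, k']) (h := fun _ => h)
      (Fin.forall_fin_two.2 ⟨hk, hk'⟩))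
  have hc : Tendsto (fun x : ℝ × ℝ => ![x.1, x.2]) (𝓝[≠] 0 ×ˢ 𝓝[≠] 0)
      (𝓝[{t : Fin 2 → ℝ | ∀ j, t j ≠ 0}] 0) := by
    refine tendsto_nhdsWithin_iff.2 ⟨tendsto_pi_nhds.2 (Fin.forall_fin_two.2 ⟨?_, ?_⟩), ?_⟩
    · exact tendsto_fst.mono_right nhdsWithin_le_nhds
    · exact tendsto_snd.mono_right nhdsWithin_le_nhds
    · filter_upwards [prod_mem_prod self_mem_nhdsWithin self_mem_nhdsWithin] with x hx
      exact Fin.forall_fin_two.2 hx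
  refine (hlim.comp hc).congr fun x => ?_
  simp only [Function.comp_apply, sum_finset_fin_two, Fin.prod_univ_two]
  rw [applyFam_empty, applyFam_singleton, applyFam_singleton, applyFam_univ_fin_two]
  simp only [Matrix.cons_val_zero, Matrix.cons_val_one, Finset.card_empty,
    Finset.card_singleton, Finset.card_univ, Fintype.card_fin]
  congr 1
  norm_num
  ring

theorem PathDiffAt.hasDerivAt {σ : ℝ → E → RS} {p : ℝ} {h : ℂ → ℂ}
    (hp : PathDiffAt E X σ p A hA h) {f : (E → RS) → ℂ} {L : (Fin 1 → ℂ → ℂ) → ℂ}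
    (hL : HasKDeriv E X f (σ p) A hA 1 L) :
    HasDerivAt (fun t => f (σ t)) (L fun _ => h) p := by
  obtain ⟨-, -, hh, G, hG⟩ := hp
  rw [hasDerivAt_iff_tendsto_slope_zero]
  refine (hL.tendsto_one hh hG.familyTo).congr fun x => ?_
  rw [show actF E (G (p + x)) (σ p) = σ (p + x) from funext (hG.1 (p + x))]

theorem exists_seq_compact_exhausting {U : Set ℂ} (hU : IsOpen U) :
    ∃ K : ℕ → Set ℂ, (∀ n, IsCompact (K n) ∧ K n ⊆ U) ∧
      ∀ C ⊆ U, IsCompact C → ∀ᶠ n in atTop, C ⊆ K n := by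
  have : LocallyCompactSpace U := hU.locallyCompactSpace
  let K := CompactExhaustion.choice U
  refine ⟨fun n => (↑) '' K n, fun n => ⟨(K.isCompact n).image continuous_subtype_val, ?_⟩,
    fun C hC hC' => ?_⟩
  · rintro _ ⟨x, -, rfl⟩
    exact x.2
  · obtain ⟨m, hm⟩ := K.exists_superset_of_isCompact
      (s := ((↑) : U → ℂ) ⁻¹' C) (Subtype.isCompact_iff.2 (by
        rwa [Subtype.image_preimage_coe, inter_eq_right.2 hC]))
    filter_upwards [eventually_ge_atTop m] with n hn x hx
    exact ⟨⟨x, hC hx⟩, K.subset hn (hm hx), rfl⟩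

theorem isOpen_finitePart (hA : IsDomain A) : IsOpen (finitePart A) :=
  hA.1.preimage OnePoint.continuous_coe

/-- The derivative of `f` along a smooth path is sequentially continuous where `f` has a second
differential: the second difference is evaluated at increments of the path from `σ (s n)`,
chosen small enough to be uniformly close to their directions. -/
theorem SmoothPathData.tendsto_deriv {σ : ℝ → E → RS} {u v : ℝ} {Dir : ℝ → ℂ → ℂ}
    (hσ : SmoothPathData E X σ u v A hA Dir) {f : (E → RS) → ℂ} {F' : ℝ → ℂ}
    {L₁ : (Fin 1 → ℂ → ℂ) → ℂ} {L₂ : (Fin 2 → ℂ → ℂ) → ℂ} {p : ℝ} (hp : p ∈ Icc u v)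
    (hF' : ∀ t ∈ Icc u v, HasDerivAt (fun t => f (σ t)) (F' t) t)
    (hL₁ : HasKDeriv E X f (σ p) A hA 1 L₁) (hL₂ : HasKDeriv E X f (σ p) A hA 2 L₂)
    {s : ℕ → ℝ} (hs : Tendsto s atTop (𝓝[Icc u v \ {p}] p)) :
    Tendsto (fun n => F' (s n)) atTop (𝓝 (F' p)) := by
  obtain ⟨hsp, hsI⟩ := tendsto_nhdsWithin_iff.1 hs
  have hDir : Dir p ∈ HVFset A := (hσ.1 p hp).2.2.1
  have hF'p : F' p = L₁ fun _ => Dir p := (hF' p hp).unique ((hσ.1 p hp).hasDerivAt hL₁)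
  choose G' hG' using fun t ht => (hσ.1 t ht).2.2.2
  let G : ℝ → ℝ → ConfMap := fun t => if ht : t ∈ Icc u v then G' t ht else G' p hp
  have hG : ∀ t ∈ Icc u v, DiffQuotOK E X A hA σ t (G t) (Dir t) := fun t ht => by
    simpa only [G, dif_pos ht] using hG' t ht
  obtain ⟨K, hK, hKex⟩ := exists_seq_compact_exhausting (isOpen_finitePart hA)
  let w : ℕ → ℝ := fun k => 1 / ((k : ℝ) + 1)
  have hwpos (k : ℕ) : 0 < w k := Nat.one_div_pos_of_nat
  have hw : Tendsto w atTop (𝓝[≠] 0) :=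
    tendsto_nhdsWithin_iff.2 ⟨tendsto_one_div_add_atTop_nhds_zero_nat,
      .of_forall fun k => (hwpos k).ne'⟩
  have hwinj : Function.Injective w := fun a b hab => by
    simpa [w] using hab
  obtain ⟨e, he, hP⟩ := extraction_forall_of_eventually
    (P := fun n k => s n ∈ Icc u v →
      dist ((w k)⁻¹ • (f (σ (s n + w k)) - f (σ (s n)))) (F' (s n)) < w n ∧
      dist (deltaA (X A hA) (G (s n) (s n + w k))) 0 < w n ∧
      ∀ y ∈ K n, dist (Dir (s n) y)
        ((w k)⁻¹ • (toC ((G (s n) (s n + w k)).toFun (y : RS)) - y)) < w n) (by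
    intro n
    by_cases hn : s n ∈ Icc u v
    · have hfam := (hG _ hn).familyTo
      have h₁ := (hasDerivAt_iff_tendsto_slope_zero.1 (hF' _ hn)).comp hw
      have h₂ := hfam.1.comp (hw.mono_right nhdsWithin_le_nhds)
      have h₃ := (tendstoLocallyUniformlyOn_iff_forall_isCompact
        (isOpen_finitePart hA)).1 hfam.2 (K n) (hK n).2 (hK n).1
      filter_upwards [h₁ (Metric.ball_mem_nhds _ (hwpos n)),
        h₂ (Metric.ball_mem_nhds _ (hwpos n)),
        hw.eventually (Metric.tendstoUniformlyOn_iff.1 h₃ _ (hwpos n))] with k hk₁ hk₂ hk₃ _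
      exact ⟨hk₁, hk₂, hk₃⟩
    · exact .of_forall fun k hk => absurd hk hn)
  let ε : ℕ → ℝ := fun n => w (e n)
  let H : ℕ → ConfMap := fun n => G (s n) (s n + ε n)
  have hε : Tendsto ε atTop (𝓝[≠] 0) := hw.comp he.tendsto_atTop
  have hεne (n : ℕ) : ε n ≠ 0 := (hwpos _).ne'
  have hεinj : Function.Injective ε := hwinj.comp he.injective
  have hw0 := hw.mono_right nhdsWithin_le_nhds
  have hδ : Tendsto (fun n => deltaA (X A hA) (H n)) atTop (𝓝 0) := by
    rw [tendsto_iff_dist_tendsto_zero]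
    refine squeeze_zero' (.of_forall fun _ => dist_nonneg) ?_ hw0
    filter_upwards [hsI] with n hn
    exact (hP n hn.1).2.1.le
  have hq : TendstoLocallyUniformlyOn
      (fun n (z : ℂ) => (ε n)⁻¹ • (toC ((H n).toFun (z : RS)) - z)) (Dir p) atTop
      (finitePart A) := by
    rw [tendstoLocallyUniformlyOn_iff_forall_isCompact (isOpen_finitePart hA)]
    intro C hC hC'
    rw [Metric.tendstoUniformlyOn_iff]
    intro η hη
    have hD := Metric.tendstoUniformlyOn_iff.1
      ((tendstoLocallyUniformlyOn_iff_forall_isCompact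
        (isOpen_finitePart hA)).1 (hσ.2 p hp).1 C hC hC') (η / 2) (half_pos hη)
    filter_upwards [hsp.eventually hD, hsI, hKex C hC hC',
      hw0.eventually (gt_mem_nhds (half_pos hη))] with n hn₁ hn₂ hn₃ hn₄ y hy
    calc dist (Dir p y) _ ≤ dist (Dir p y) (Dir (s n) y) + dist (Dir (s n) y) _ :=
          dist_triangle _ _ _
      _ < η / 2 + η / 2 :=
          add_lt_add (hn₁ y hy) (((hP n hn₂.1).2.2 y (hn₃ hy)).trans hn₄)
      _ = η := add_halves η
  have hk := (hG p hp).familyTo.extend hεinj hεne hδ hq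
  set k := Function.extend ε H fun x => G p (p + x)
  have hkε (n : ℕ) : k (ε n) = H n := hεinj.extend_apply _ _ n
  have hsub : Tendsto (fun n => s n - p) atTop (𝓝[≠] 0) := by
    refine tendsto_nhdsWithin_iff.2 ⟨by simpa using hsp.sub_const p, ?_⟩
    filter_upwards [hsI] with n hn
    exact sub_ne_zero.2 hn.2
  have hone := (hL₁.tendsto_one hDir hk).comp hε
  have htwo := (hL₂.tendsto_two hDir hk (hG p hp).familyTo).comp (hε.prodMk hsub)
  have hquot : Tendsto (fun n => (ε n)⁻¹ • (f (σ (s n + ε n)) - f (σ (s n)))) atTop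
      (𝓝 (F' p)) := by
    have hsum := ((hsub.mono_right nhdsWithin_le_nhds).smul htwo).add hone
    rw [zero_smul, zero_add, ← hF'p] at hsum
    refine hsum.congr' ?_
    filter_upwards [hsI] with n hn
    have hsn : s n - p ≠ 0 := sub_ne_zero.2 hn.2
    have h₁ : actF E (G p (p + (s n - p))) (σ p) = σ (s n) := by
      rw [add_sub_cancel]
      exact funext ((hG p hp).1 _)
    have h₂ : actF E (H n) (σ (s n)) = σ (s n + ε n) := funext ((hG _ hn.1).1 _)
    simp only [Function.comp_apply, hkε, h₁, h₂, smul_smul]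
    rw [mul_inv, mul_comm (ε n)⁻¹, mul_inv_cancel_left₀ hsn, ← smul_add]
    congr 1
    ring
  refine hquot.congr_dist (squeeze_zero' (.of_forall fun _ => dist_nonneg) ?_ hw0)
  filter_upwards [hsI] with n hn
  exact (hP n hn.1).1.le

end Differentials

end CFT

open CFT Set Filter Topology in
/-- Lemma 2.16 of the paper, fundamental theorem of calculus: along a
smooth path `t ↦ Σ_t` lying in a connected open set `N ⊆ Ω`, for a twice-differentiable
function `f` on `N`, the integrand `t ↦ ∇_{Dσ(t)} f(Σ_t)` is continuous and
`∫₀¹ ∇_{Dσ(t)} f(Σ_t) dt = f(Σ₁) − f(Σ₀)`. -/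
theorem integral_of_derivative_along_path
    (E : Set RS) (hE : IsAnnular E) (X : ExhChoice)
    (D : (ℂ → ℂ) → ((E → RS) → ℂ) → (E → RS) → ℂ) (hD : IsNablaOp E X D)
    (N : Set (E → RS)) (hN : ConfOpen E X N)
    -- connectedness of `N` in the conformal topology
    (hNconn : ∀ U V : Set (E → RS), ConfOpen E X U → ConfOpen E X V →
      N ⊆ U ∪ V → (U ∩ N).Nonempty → (V ∩ N).Nonempty → (U ∩ V ∩ N).Nonempty)
    (σ : ℝ → E → RS) (B : Set RS) (hB : IsDomain B) (Dir : ℝ → ℂ → ℂ)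
    (hσ : SmoothPathData E X σ 0 1 B hB Dir)
    (hσN : ∀ t ∈ Icc (0 : ℝ) 1, σ t ∈ N)
    (f : (E → RS) → ℂ) (hf : ∀ φ ∈ N, KTimesDiffAt E X f 2 φ) :
    ContinuousOn (fun t => D (Dir t) f (σ t)) (Icc (0 : ℝ) 1) ∧
    ∫ t in (0 : ℝ)..1, D (Dir t) f (σ t) = f (σ 1) - f (σ 0) := by
  have hL₂ : ∀ t ∈ Icc (0 : ℝ) 1, ∃ L, HasKDeriv E X f (σ t) B hB 2 L := fun t ht =>
    (hf _ (hσN t ht) B hB (hσ.1 t ht).2.1).1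
  have hL₁ : ∀ t ∈ Icc (0 : ℝ) 1, ∃ L, HasKDeriv E X f (σ t) B hB 1 L := fun t ht => by
    obtain ⟨M, -, htM, -, hM⟩ := (hf _ (hσN t ht) B hB (hσ.1 t ht).2.1).2 le_rfl
    exact (hM _ htM).1
  have hderiv : ∀ t ∈ Icc (0 : ℝ) 1,
      HasDerivAt (fun t => f (σ t)) (D (Dir t) f (σ t)) t := fun t ht => by
    obtain ⟨L, hL⟩ := hL₁ t ht
    have hDL : D (Dir t) f (σ t) = L fun _ => Dir t :=
      hD f (σ t) B hB 1 L (fun _ => Dir t) one_pos (fun _ => (hσ.1 t ht).2.2.1) hL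
    rw [hDL]
    exact (hσ.1 t ht).hasDerivAt hL
  have hcont : ContinuousOn (fun t => D (Dir t) f (σ t)) (Icc (0 : ℝ) 1) := fun p hp => by
    obtain ⟨L₁, hL₁⟩ := hL₁ p hp
    obtain ⟨L₂, hL₂⟩ := hL₂ p hp
    rw [← continuousWithinAt_sdiff_self]
    exact tendsto_of_seq_tendsto fun s hs => hσ.tendsto_deriv hp hderiv hL₁ hL₂ hs
  refine ⟨hcont, intervalIntegral.integral_eq_sub_of_hasDerivAt (f := fun t => f (σ t)) ?_ ?_⟩
  · rwa [uIcc_of_le zero_le_one]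
  · exact ContinuousOn.intervalIntegrable (by rwa [uIcc_of_le zero_le_one])
end
end

section
/- Let f be a function on an open subset N ⊆ Ω, differentiable at Σ ∈ N, let h be a holomorphic vector field on a simply connected domain A ⊃ α(Σ), and let w ∈ α(Σ). If Δ[h_{n;w}] f(Σ) = 0 for all but finitely many n ≥ −1, then Δ[h] f(Σ) = Σ_{n=−1}^{∞} [ (−1)^{n+1} / (n+1)! ] · ∂^{n+1} h(w) · Δ[h_{n;w}] f(Σ), where the sum has only finitely many nonzero terms. -/
open Set Filter Topology

noncomputable section

attribute [local instance] Classical.propDecidable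

section CauchyPompeiu

open MeasureTheory

/-- The Cauchy–Pompeiu formula for compactly supported functions, where
`fderiv ℝ u ζ 1 + I * fderiv ℝ u ζ I` is twice the `∂̄`-derivative of `u`. -/
theorem integral_dbar_div_sub_of_hasCompactSupport {u : ℂ → ℂ} (hu : ContDiff ℝ 1 u)
    (hc : HasCompactSupport u) (z : ℂ) :
    ∫ ζ, (fderiv ℝ u ζ 1 + Complex.I * fderiv ℝ u ζ Complex.I) / (ζ - z) =
      -(2 * Real.pi) * u z := by
  have hd : ∀ ζ, HasFDerivAt u (fderiv ℝ u ζ) ζ :=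
    fun ζ => (hu.differentiable one_ne_zero ζ).hasFDerivAt
  have hcont : Continuous (fderiv ℝ u) := hu.continuous_fderiv one_ne_zero
  obtain ⟨R, hR⟩ := hc.isBounded.subset_closedBall z
  have hzero : ∀ ζ, ζ ∉ Metric.closedBall z R → fderiv ℝ u ζ = 0 := fun ζ hζ =>
    image_eq_zero_of_notMem_tsupport fun hm => hζ (hR (tsupport_fderiv_subset ℝ hm))
  let e : ℝ → ℂ := fun θ => Complex.exp (θ * Complex.I)
  have he : ∀ θ, e θ = Real.cos θ + Real.sin θ * Complex.I := fun θ => by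
    simp only [e, Complex.exp_mul_I, Complex.ofReal_cos, Complex.ofReal_sin]
  have hecont : Continuous e := by fun_prop
  have henorm : ∀ θ, ‖e θ‖ = 1 := fun θ => Complex.norm_exp_ofReal_mul_I θ
  have hed : ∀ θ, HasDerivAt e (Complex.I * e θ) θ := fun θ => by
    have h1 : HasDerivAt (fun θ : ℝ => (θ : ℂ) * Complex.I) (1 * Complex.I) θ :=
      (Complex.ofRealCLM.hasDerivAt (x := θ)).mul_const Complex.I
    have h2 := h1.cexp
    rw [one_mul, mul_comm] at h2
    exact h2
  let P : ℝ × ℝ → ℂ := fun p => z + p.1 * e p.2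
  have hP : Continuous P := by fun_prop
  have hPmem : ∀ p : ℝ × ℝ, R < p.1 → P p ∉ Metric.closedBall z R := fun p hp hm => by
    rw [Metric.mem_closedBall, dist_eq_norm] at hm
    simp only [P, add_sub_cancel_left, norm_mul, henorm, mul_one, Complex.norm_real] at hm
    exact absurd (le_of_abs_le (by simpa using hm)) (not_le.mpr hp)
  let a : ℝ × ℝ → ℂ := fun p => fderiv ℝ u (P p) (e p.2)
  let b : ℝ × ℝ → ℂ := fun p => fderiv ℝ u (P p) (Complex.I * e p.2)
  have ha : Continuous a := (hcont.comp hP).clm_apply (by fun_prop)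
  have hb : Continuous b := (hcont.comp hP).clm_apply (by fun_prop)
  have hint : ∀ g : ℝ × ℝ → ℂ, Continuous g → (∀ p : ℝ × ℝ, R < p.1 → g p = 0) →
      IntegrableOn g (Ioi 0 ×ˢ Ioo (-Real.pi) Real.pi) := fun g hg h0 => by
    have hK : IntegrableOn g (Icc 0 R ×ˢ Icc (-Real.pi) Real.pi) :=
      hg.continuousOn.integrableOn_compact (isCompact_Icc.prod isCompact_Icc)
    refine IntegrableOn.of_forall_sdiff_eq_zero hK (measurableSet_Ioi.prod measurableSet_Ioo) ?_
    rintro p ⟨⟨hp1, hp2⟩, hp⟩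
    refine h0 p ?_
    by_contra hle
    exact hp ⟨⟨le_of_lt hp1, not_lt.mp hle⟩, Ioo_subset_Icc_self hp2⟩
  have hia := hint a ha fun p hp => by simp [a, hzero _ (hPmem p hp)]
  have hib := hint b hb fun p hp => by simp [b, hzero _ (hPmem p hp)]
  have hinta : ∫ p in Ioi 0 ×ˢ Ioo (-Real.pi) Real.pi, a p = -(2 * Real.pi) * u z := by
    rw [Measure.volume_eq_prod, ← setIntegral_prod_swap, setIntegral_prod (fun p => a p.swap) hia.swap]
    have hr : ∀ θ : ℝ, ∫ r in Ioi (0 : ℝ), a (Prod.swap (θ, r)) = -u z := fun θ => by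
      have hdr : ∀ r : ℝ, HasDerivAt (fun r : ℝ => u (P (r, θ))) (a (r, θ)) r := fun r => by
        have h1 : HasDerivAt (fun r : ℝ => P (r, θ)) (e θ) r := by
          have h2 : HasDerivAt (fun r : ℝ => (r : ℂ) * e θ) (1 * e θ) r :=
            (Complex.ofRealCLM.hasDerivAt (x := r)).mul_const (e θ)
          rw [one_mul] at h2
          exact h2.const_add z
        exact (hd _).comp_hasDerivAt r h1
      have hcs : HasCompactSupport (fun r : ℝ => u (P (r, θ))) := by
        refine HasCompactSupport.intro (isCompact_Icc (a := -R) (b := R)) fun r hr => ?_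
        refine image_eq_zero_of_notMem_tsupport fun hm => hr ?_
        have h3 := hR hm
        rw [Metric.mem_closedBall, dist_eq_norm] at h3
        simp only [P, add_sub_cancel_left, norm_mul, henorm, mul_one, Complex.norm_real] at h3
        exact abs_le.mp (by simpa using h3)
      have hcd : ContDiff ℝ 1 (fun r : ℝ => u (P (r, θ))) := by
        refine hu.comp ?_
        change ContDiff ℝ 1 fun r : ℝ => z + (r : ℂ) * e θ
        exact contDiff_const.add (Complex.ofRealCLM.contDiff.mul contDiff_const)
      have h4 := hcs.integral_Ioi_deriv_eq hcd 0
      simp only [(hdr _).deriv] at h4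
      simpa [P] using h4
    simp only [hr]
    simp only [integral_const, smul_neg, measureReal_restrict_apply_univ, Real.volume_real_Ioo]
    rw [max_eq_left (by linarith [Real.pi_pos])]
    simp only [Complex.real_smul]
    push_cast
    ring
  have hintb : ∫ p in Ioi 0 ×ˢ Ioo (-Real.pi) Real.pi, b p = 0 := by
    rw [Measure.volume_eq_prod, setIntegral_prod _ hib]
    refine setIntegral_eq_zero_of_forall_eq_zero fun r hr => ?_
    have hr0 : (r : ℂ) ≠ 0 := Complex.ofReal_ne_zero.mpr (ne_of_gt hr)
    have hdθ : ∀ θ : ℝ, HasDerivAt (fun θ : ℝ => u (P (r, θ))) (r * b (r, θ)) θ := fun θ => by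
      have h1 : HasDerivAt (fun θ : ℝ => P (r, θ)) (r * (Complex.I * e θ)) θ :=
        ((hed θ).const_mul (r : ℂ)).const_add z
      have h2 := (hd (P (r, θ))).comp_hasDerivAt θ h1
      have h3 : fderiv ℝ u (P (r, θ)) (r * (Complex.I * e θ)) = r * b (r, θ) := by
        rw [← Complex.real_smul, map_smul, Complex.real_smul]
      rw [h3] at h2
      exact h2
    have hcb : Continuous fun θ : ℝ => (r : ℂ) * b (r, θ) := by fun_prop
    have h4 := intervalIntegral.integral_eq_sub_of_hasDerivAt (a := -Real.pi) (b := Real.pi)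
      (fun θ _ => hdθ θ) (hcb.intervalIntegrable _ _)
    have h5 : P (r, Real.pi) = P (r, -Real.pi) := by simp [P, he]
    rw [h5, sub_self, intervalIntegral.integral_const_mul,
      intervalIntegral.integral_of_le (by linarith [Real.pi_pos]),
      integral_Ioc_eq_integral_Ioo] at h4
    exact (mul_eq_zero.mp h4).resolve_left hr0
  rw [← integral_add_left_eq_self _ z, ← Complex.integral_comp_polarCoord_symm, polarCoord_target]
  calc _ = ∫ p in Ioi 0 ×ˢ Ioo (-Real.pi) Real.pi, (a p + Complex.I * b p) := by
        refine setIntegral_congr_fun (measurableSet_Ioi.prod measurableSet_Ioo) ?_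
        rintro ⟨r, θ⟩ ⟨hr, -⟩
        have hr0 : (r : ℂ) ≠ 0 := Complex.ofReal_ne_zero.mpr (ne_of_gt hr)
        have hpol : (Complex.polarCoord.symm (r, θ) : ℂ) = r * e θ := by
          rw [Complex.polarCoord_symm_apply, he]
        have he0 : e θ ≠ 0 := Complex.exp_ne_zero _
        have hlin : ∀ (M : ℂ →L[ℝ] ℂ) (x y : ℝ), M (x + y * Complex.I) =
            x * M 1 + y * M Complex.I := fun M x y => by
          have h6 : ((x : ℂ) + y * Complex.I) = x • (1 : ℂ) + y • Complex.I := by simp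
          rw [h6, map_add, map_smul, map_smul, Complex.real_smul, Complex.real_smul]
        simp only [hpol, add_sub_cancel_left, Complex.real_smul]
        change (r : ℂ) * ((fderiv ℝ u (P (r, θ)) 1 + Complex.I * fderiv ℝ u (P (r, θ)) Complex.I) /
          (r * e θ)) = a (r, θ) + Complex.I * b (r, θ)
        have ha' : a (r, θ) = Real.cos θ * fderiv ℝ u (P (r, θ)) 1 +
            Real.sin θ * fderiv ℝ u (P (r, θ)) Complex.I := by
          simp only [a]
          rw [he, hlin]
        have hb' : b (r, θ) = ((-Real.sin θ : ℝ) : ℂ) * fderiv ℝ u (P (r, θ)) 1 +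
            Real.cos θ * fderiv ℝ u (P (r, θ)) Complex.I := by
          simp only [b]
          rw [he, ← hlin]
          congr 1
          push_cast
          linear_combination (Complex.sin θ) * Complex.I_mul_I
        have hcs : (Real.cos θ : ℂ) ^ 2 + (Real.sin θ : ℂ) ^ 2 = 1 := by
          exact_mod_cast Real.cos_sq_add_sin_sq θ
        rw [← mul_div_assoc, mul_div_mul_left _ _ hr0, div_eq_iff he0, ha', hb', he]
        push_cast at hcs ⊢
        generalize fderiv ℝ u (P (r, θ)) 1 = m
        generalize fderiv ℝ u (P (r, θ)) Complex.I = n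
        have hI := Complex.I_sq
        generalize Complex.I = i at *
        generalize Complex.cos θ = c at *
        generalize Complex.sin θ = s at *
        linear_combination (-(m + i * n)) * hcs + (s ^ 2 * m  - c * s * n) * hI
    _ = -(2 * Real.pi) * u z := by
        have hib' : IntegrableOn (fun p => Complex.I * b p)
            (Ioi 0 ×ˢ Ioo (-Real.pi) Real.pi) := hib.const_mul _
        rw [integral_add hia hib', hinta, integral_const_mul, hintb]
        simp

end CauchyPompeiu

section Runge

open MeasureTheory

/-- A closed subspace contains the Bochner integral of any function with values in it. -/
theorem Submodule.integral_mem_of_isClosed {α F : Type*} [MeasurableSpace α] {μ : Measure α}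
    [NormedAddCommGroup F] [NormedSpace ℝ F] [CompleteSpace F] (S : Submodule ℝ F)
    (hS : IsClosed (S : Set F)) {g : α → F} (hg : ∀ x, g x ∈ S) : ∫ x, g x ∂μ ∈ S := by
  have : CompleteSpace S := hS.completeSpace_coe
  have h1 : ∫ x, g x ∂μ = S.subtypeₗᵢ (∫ x, (⟨g x, hg x⟩ : S) ∂μ) :=
    S.subtypeₗᵢ.integral_comp_comm (μ := μ) fun x => (⟨g x, hg x⟩ : S)
  rw [h1]
  exact (∫ x, (⟨g x, hg x⟩ : S) ∂μ).2

/-- A holomorphic function near a compact set `K` is the product-with-cutoff restriction of a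
compactly supported `C¹` function that agrees with it near `K`. -/
theorem exists_contDiff_hasCompactSupport_eventuallyEq {K U : Set ℂ} (hK : IsCompact K)
    (hU : IsOpen U) (hKU : K ⊆ U) {h : ℂ → ℂ} (hh : DifferentiableOn ℂ h U) :
    ∃ u : ℂ → ℂ, ContDiff ℝ 1 u ∧ HasCompactSupport u ∧ ∀ z ∈ K, u =ᶠ[𝓝 z] h := by
  obtain ⟨t, ht, hKt, htU⟩ := exists_compact_between hK hU hKU
  obtain ⟨χ, hχ1, hχ0, -⟩ := exists_contMDiffMap_one_nhds_of_subset_interior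
    (modelWithCornersSelf ℝ ℂ) (n := 1) hK.isClosed hKt
  have hχ : ContDiff ℝ 1 χ := χ.contMDiff.contDiff
  refine ⟨fun z => χ z • h z, ?_, HasCompactSupport.intro ht fun z hz => by simp [hχ0 z hz],
    fun z hz => ?_⟩
  · rw [contDiff_iff_contDiffAt]
    intro z
    by_cases hz : z ∈ U
    · have h1 : ContDiffAt ℝ 1 h z :=
        ((hh.analyticAt (hU.mem_nhds hz)).contDiffAt (n := 1)).restrict_scalars ℝ
      exact hχ.contDiffAt.smul h1
    · have h2 : (fun z => χ z • h z) =ᶠ[𝓝 z] fun _ => 0 := by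
        filter_upwards [ht.isClosed.isOpen_compl.mem_nhds fun hzt => hz (htU hzt)] with y hy
        simp [hχ0 y hy]
      exact contDiffAt_const.congr_of_eventuallyEq h2
  · filter_upwards [hχ1.filter_mono (nhds_le_nhdsSet hz)] with y hy
    simp [hy]

/-- **Runge's theorem** for compact sets all of whose complementary components are unbounded. -/
theorem exists_polynomial_tendstoUniformlyOn {K U : Set ℂ} (hK : IsCompact K)
    (hU : IsOpen U) (hKU : K ⊆ U) {h : ℂ → ℂ} (hh : DifferentiableOn ℂ h U)
    (hunb : ∀ z ∉ K, ¬ Bornology.IsBounded (connectedComponentIn Kᶜ z)) :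
    ∃ p : ℕ → Polynomial ℂ, TendstoUniformlyOn (fun n z => (p n).eval z) h atTop K := by
  have : CompactSpace K := isCompact_iff_compactSpace.mp hK
  obtain ⟨u, hu, huc, huh⟩ := exists_contDiff_hasCompactSupport_eventuallyEq hK hU hKU hh
  let S : Subalgebra ℂ C(K, ℂ) := (polynomialFunctions K).topologicalClosure
  have hSc : IsClosed (S : Set C(K, ℂ)) := Subalgebra.isClosed_topologicalClosure _
  have : IsClosed (S : Set C(K, ℂ)) := hSc
  let X : C(K, ℂ) := (Polynomial.toContinuousMapOnAlgHom K) Polynomial.X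
  have hX : ∀ z : K, X z = z := fun z => by simp [X]
  have hXS : X ∈ S := Subalgebra.le_topologicalClosure _ ⟨Polynomial.X, trivial, rfl⟩
  have hspec : spectrum ℂ X = K := by
    rw [ContinuousMap.spectrum_eq_range]
    ext z
    exact ⟨fun ⟨y, hy⟩ => by rw [← hy, hX]; exact y.2, fun hz => ⟨⟨z, hz⟩, hX _⟩⟩
  let T : ℂ → C(K, ℂ) := fun ζ => algebraMap ℂ C(K, ℂ) ζ - X
  have hunit : ∀ ζ ∉ K, IsUnit (T ζ) := fun ζ hζ => by
    rw [← hspec] at hζ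
    exact spectrum.notMem_iff.mp hζ
  have hres : ∀ ζ ∉ K, Ring.inverse (T ζ) ∈ S := fun ζ hζ => by
    have h1 : ζ ∉ spectrum ℂ (⟨X, hXS⟩ : S) := fun hm => by
      have h2 := Subalgebra.spectrum_isBounded_connectedComponentIn S ⟨X, hXS⟩ hm
      rw [show ((⟨X, hXS⟩ : S) : C(K, ℂ)) = X from rfl, hspec] at h2
      exact hunb ζ hζ h2
    obtain ⟨v, hv⟩ := spectrum.notMem_iff.mp h1
    have h3 : T ζ = (Units.map (S.val : S →* C(K, ℂ)) v : C(K, ℂ)) :=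
      (congrArg Subtype.val hv).symm
    rw [h3, Ring.inverse_unit]
    exact (v⁻¹ : Sˣ).val.2
  have heval : ∀ ζ ∉ K, ∀ z : K, Ring.inverse (T ζ) z = (ζ - z)⁻¹ := fun ζ hζ z => by
    have h1 := congrArg (fun g : C(K, ℂ) => g z) (Ring.mul_inverse_cancel _ (hunit ζ hζ))
    have h2 : T ζ z = ζ - z := by simp [T, hX, algebraMap_apply]
    simp only [ContinuousMap.mul_apply, h2, ContinuousMap.one_apply] at h1
    exact eq_inv_of_mul_eq_one_right h1
  let d : ℂ → ℂ := fun ζ => fderiv ℝ u ζ 1 + Complex.I * fderiv ℝ u ζ Complex.I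
  have hfd : Continuous (fderiv ℝ u) := hu.continuous_fderiv one_ne_zero
  have hdc : Continuous d := by fun_prop
  have hd0 : ∀ z ∈ K, d =ᶠ[𝓝 z] 0 := fun z hz => by
    filter_upwards [(huh z hz).eventually_nhds, hU.mem_nhds (hKU hz)] with y hy hyU
    have h1 : HasDerivAt h (deriv h y) y :=
      (hh.differentiableAt (hU.mem_nhds hyU)).hasDerivAt
    have h2 : fderiv ℝ u y = (ContinuousLinearMap.toSpanSingleton ℂ (deriv h y)).restrictScalars ℝ :=
      ((h1.hasFDerivAt.restrictScalars ℝ).congr_of_eventuallyEq hy).fderiv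
    simp only [d, h2, Pi.zero_apply]
    simp
    linear_combination (deriv h y) * Complex.I_mul_I
  let Φ : ℂ → C(K, ℂ) := fun ζ => d ζ • Ring.inverse (T ζ)
  have hΦc : Continuous Φ := by
    rw [continuous_iff_continuousAt]
    intro ζ
    by_cases hζ : ζ ∈ K
    · have h1 : Φ =ᶠ[𝓝 ζ] fun _ => 0 := by
        filter_upwards [hd0 ζ hζ] with y hy
        simp [Φ, hy]
      exact continuousAt_const.congr h1.symm
    · have hT : Continuous T := by fun_prop
      obtain ⟨v, hv⟩ := hunit ζ hζ
      have h2 : ContinuousAt Ring.inverse (T ζ) := hv ▸ NormedRing.inverse_continuousAt v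
      exact hdc.continuousAt.smul (ContinuousAt.comp (f := T) h2 hT.continuousAt)
  have hΦs : HasCompactSupport Φ := by
    refine HasCompactSupport.intro huc fun ζ hζ => ?_
    have h1 : fderiv ℝ u ζ = 0 :=
      image_eq_zero_of_notMem_tsupport fun hm => hζ (tsupport_fderiv_subset ℝ hm)
    simp [Φ, d, h1]
  have hΦi : Integrable Φ := hΦc.integrable_of_hasCompactSupport hΦs
  have hΦS : ∀ ζ, Φ ζ ∈ S := fun ζ => by
    by_cases hζ : ζ ∈ K
    · simp [Φ, (hd0 ζ hζ).self_of_nhds]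
    · exact S.smul_mem (hres ζ hζ) _
  have hJ : (∫ ζ, Φ ζ) ∈ S :=
    Submodule.integral_mem_of_isClosed ((Subalgebra.toSubmodule S).restrictScalars ℝ) hSc hΦS
  have hJev : ∀ z : K, (∫ ζ, Φ ζ) z = -(2 * Real.pi) * h z := fun z => by
    have h1 := (ContinuousMap.evalCLM ℂ z).integral_comp_comm hΦi
    rw [← (huh z z.2).self_of_nhds, ← integral_dbar_div_sub_of_hasCompactSupport hu huc]
    refine h1.symm.trans (integral_congr_ae (Eventually.of_forall fun ζ => ?_))
    change d ζ * Ring.inverse (T ζ) z = d ζ / (ζ - z)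
    by_cases hζ : ζ ∈ K
    · simp [(hd0 ζ hζ).self_of_nhds]
    · rw [heval ζ hζ, div_eq_mul_inv]
  have hpi : (-(2 * Real.pi) : ℂ) ≠ 0 := by
    simp [Real.pi_ne_zero]
  let H : C(K, ℂ) := (-(2 * Real.pi) : ℂ)⁻¹ • ∫ ζ, Φ ζ
  have hHS : H ∈ closure (polynomialFunctions K : Set C(K, ℂ)) := S.smul_mem hJ _
  have hH : ∀ z : K, H z = h z := fun z => by
    change (-(2 * Real.pi) : ℂ)⁻¹ * (∫ ζ, Φ ζ) z = h z
    rw [hJev, inv_mul_cancel_left₀ hpi]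
  obtain ⟨q, hq, hqt⟩ := mem_closure_iff_seq_limit.mp hHS
  choose p hp using hq
  refine ⟨p, ?_⟩
  intro V hV
  filter_upwards [ContinuousMap.tendsto_iff_tendstoUniformly.mp hqt V hV] with n hn z hz
  have h1 := hn ⟨z, hz⟩
  rw [hH, ← (hp n).2] at h1
  simpa using h1

end Runge

section SphereTopology

theorem closure_connectedComponentIn_inter_subset {T : Type*} [TopologicalSpace T] (F : Set T)
    (x : T) : closure (connectedComponentIn F x) ∩ F ⊆ connectedComponentIn F x := by
  rintro y ⟨hy, hyF⟩
  obtain ⟨a, ha⟩ := closure_nonempty_iff.mp ⟨y, hy⟩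
  have h1 : IsPreconnected (insert y (connectedComponentIn F x)) :=
    isPreconnected_connectedComponentIn.subset_closure (subset_insert _ _)
      (insert_subset hy subset_closure)
  rw [connectedComponentIn_eq ha]
  exact h1.subset_connectedComponentIn (mem_insert_of_mem _ ha)
    (insert_subset hyF (connectedComponentIn_subset F x)) (mem_insert _ _)

/-- In a regular locally connected space, a compact subset of an open connected set `V` is
contained in an open connected set whose closure is contained in `V`. -/
theorem IsCompact.exists_isPreconnected_closure_subset {T : Type*} [TopologicalSpace T]
    [RegularSpace T] [LocallyConnectedSpace T] {V C : Set T} {p : T} (hC : IsCompact C)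
    (hV : IsOpen V) (hVc : IsPreconnected V) (hp : p ∈ V) (hCV : C ⊆ V) :
    ∃ O, IsOpen O ∧ IsPreconnected O ∧ p ∈ O ∧ C ⊆ O ∧ closure O ⊆ V := by
  have hloc : ∀ x ∈ V, ∃ W, IsOpen W ∧ x ∈ W ∧ IsPreconnected W ∧ closure W ⊆ V := by
    intro x hx
    obtain ⟨F, hF, hFc, hFV⟩ := exists_mem_nhds_isClosed_subset (hV.mem_nhds hx)
    obtain ⟨W, ⟨hWo, hxW, hWc⟩, hWF⟩ :=
      (LocallyConnectedSpace.open_connected_basis x).mem_iff.mp hF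
    exact ⟨W, hWo, hxW, hWc.isPreconnected, (closure_minimal hWF hFc).trans hFV⟩
  have hunion : ∀ {O W : Set T}, IsPreconnected O → IsPreconnected W → (O ∩ W).Nonempty →
      closure O ⊆ V → closure W ⊆ V → IsPreconnected (O ∪ W) ∧ closure (O ∪ W) ⊆ V :=
    fun hO hW ⟨q, hq1, hq2⟩ h1 h2 =>
      ⟨hO.union q hq1 hq2 hW, by rw [closure_union]; exact union_subset h1 h2⟩
  let S : Set T := {x | ∃ O, IsOpen O ∧ IsPreconnected O ∧ p ∈ O ∧ x ∈ O ∧ closure O ⊆ V}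
  have hpS : p ∈ S := by
    obtain ⟨W, h1, h2, h3, h4⟩ := hloc p hp
    exact ⟨W, h1, h3, h2, h2, h4⟩
  have hSo : IsOpen S := isOpen_iff_mem_nhds.mpr fun x ⟨O, h1, h2, h3, h4, h5⟩ =>
    mem_of_superset (h1.mem_nhds h4) fun y hy => ⟨O, h1, h2, h3, hy, h5⟩
  have hVS : V ⊆ S := by
    refine hVc.subset_of_closure_inter_subset hSo ⟨p, hp, hpS⟩ ?_
    rintro x ⟨hxS, hxV⟩
    obtain ⟨W, h1, h2, h3, h4⟩ := hloc x hxV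
    obtain ⟨y, hyW, O, g1, g2, g3, g4, g5⟩ := mem_closure_iff.mp hxS W h1 h2
    obtain ⟨k1, k2⟩ := hunion g2 h3 ⟨y, g4, hyW⟩ g5 h4
    exact ⟨O ∪ W, g1.union h1, k1, Or.inl g3, Or.inr h2, k2⟩
  refine hC.induction_on (p := fun C => ∃ O, IsOpen O ∧ IsPreconnected O ∧ p ∈ O ∧ C ⊆ O ∧
    closure O ⊆ V) ?_ ?_ ?_ ?_
  · obtain ⟨O, h1, h2, h3, -, h5⟩ := hpS
    exact ⟨O, h1, h2, h3, empty_subset _, h5⟩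
  · rintro s t hst ⟨O, h1, h2, h3, h4, h5⟩
    exact ⟨O, h1, h2, h3, hst.trans h4, h5⟩
  · rintro s t ⟨O, h1, h2, h3, h4, h5⟩ ⟨W, g1, g2, g3, g4, g5⟩
    obtain ⟨k1, k2⟩ := hunion h2 g2 ⟨p, h3, g3⟩ h5 g5
    exact ⟨O ∪ W, h1.union g1, k1, Or.inl h3, union_subset_union h4 g4, k2⟩
  · intro x hx
    obtain ⟨O, h1, h2, h3, h4, h5⟩ := hVS (hCV hx)
    exact ⟨O, mem_nhdsWithin_of_mem_nhds (h1.mem_nhds h4), O, h1, h2, h3, Subset.rfl, h5⟩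

theorem locallyConnectedSpace_onePoint_complex : LocallyConnectedSpace (OnePoint ℂ) := by
  have : Fact (Module.finrank ℝ (EuclideanSpace ℝ (Fin 3)) = 2 + 1) := ⟨by simp⟩
  have : LocallyConnectedSpace (Metric.sphere (0 : EuclideanSpace ℝ (Fin 3)) 1) :=
    ChartedSpace.locallyConnectedSpace (EuclideanSpace ℝ (Fin 2)) _
  exact (onePointEquivSphereOfFinrankEq (ι := Fin 3) (V := ℂ)
    (by simp [Complex.finrank_real_complex])).locallyConnectedSpace

/-- The complementary components of the finite part of the complement of a connected open
neighbourhood of `∞` are unbounded. -/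
theorem not_isBounded_connectedComponentIn_of_isPreconnected {O : Set (OnePoint ℂ)}
    (hO : IsOpen O) (hOc : IsPreconnected O) (hinf : OnePoint.infty ∈ O) {K : Set ℂ}
    (hK : K = {z : ℂ | (z : OnePoint ℂ) ∉ O}) {z : ℂ} (hz : z ∉ K) :
    ¬ Bornology.IsBounded (connectedComponentIn Kᶜ z) := by
  have hKc : Kᶜ = (fun z : ℂ => (z : OnePoint ℂ)) ⁻¹' O := by
    ext y
    simp [hK]
  intro hb
  have hKo : IsOpen Kᶜ := hKc ▸ hO.preimage OnePoint.continuous_coe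
  have hzO : (z : OnePoint ℂ) ∈ O := by
    have h1 : z ∈ Kᶜ := hz
    rwa [hKc] at h1
  have hWo : IsOpen (connectedComponentIn Kᶜ z) := hKo.connectedComponentIn
  have hzW : z ∈ connectedComponentIn Kᶜ z := mem_connectedComponentIn hz
  have hcl : closure ((fun z : ℂ => (z : OnePoint ℂ)) '' connectedComponentIn Kᶜ z) ⊆
      (fun z : ℂ => (z : OnePoint ℂ)) '' closure (connectedComponentIn Kᶜ z) :=
    closure_minimal (image_mono subset_closure)
      (hb.isCompact_closure.image OnePoint.continuous_coe).isClosed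
  have hsub := hOc.subset_of_closure_inter_subset
    (OnePoint.isOpenMap_coe _ hWo) ⟨z, hzO, z, hzW, rfl⟩ (by
      rintro x ⟨hx, hxO⟩
      obtain ⟨y, hy, rfl⟩ := hcl hx
      exact ⟨y, closure_connectedComponentIn_inter_subset _ _ ⟨hy, hKc ▸ hxO⟩, rfl⟩)
  obtain ⟨y, -, hy⟩ := hsub hinf
  exact OnePoint.coe_ne_infty y hy

end SphereTopology

namespace CFT

/-- A conformal map is open near a finite point with finite image. -/
theorem ConfMap.image_dom_mem_nhds (g : ConfMap) {x : RS} (hx : x ∈ g.dom)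
    (hx' : x ≠ OnePoint.infty) (hgx : g.toFun x ≠ OnePoint.infty) :
    g.toFun '' g.dom ∈ 𝓝 (g.toFun x) := by
  obtain ⟨z, rfl⟩ := OnePoint.ne_infty_iff_exists.mp hx'
  obtain ⟨v, hv⟩ := OnePoint.ne_infty_iff_exists.mp hgx
  obtain ⟨hcont, han⟩ := g.holo _ hx
  simp only [OnePoint.coe_ne_infty, if_false, if_neg hgx] at han
  have hF : ∀ᶠ y : ℂ in 𝓝 z, (y : RS) ∈ g.dom ∧ ((mapC g y : ℂ) : RS) = g.toFun (y : RS) := by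
    have h1 : Tendsto (fun y : ℂ => (y : RS)) (𝓝 z) (𝓝 (z : RS)) :=
      OnePoint.continuous_coe.continuousAt
    have h2 : ∀ᶠ q in 𝓝 (g.toFun (z : RS)), q ≠ OnePoint.infty :=
      OnePoint.isClosed_infty.isOpen_compl.mem_nhds hgx
    filter_upwards [h1.eventually (g.isOpen_dom.mem_nhds hx), h1.eventually (hcont.eventually h2)]
      with y hy1 hy2
    obtain ⟨q, hq⟩ := OnePoint.ne_infty_iff_exists.mp hy2
    refine ⟨hy1, ?_⟩
    rw [mapC, ← hq]
    rfl
  have hFz : mapC g z = v := by rw [mapC, ← hv]; rfl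
  have hana : AnalyticAt ℂ (mapC g) z := han
  rcases hana.eventually_constant_or_nhds_le_map_nhds with hconst | hopen
  · exfalso
    obtain ⟨y, ⟨⟨hy1, hy2⟩, hy3⟩, hyz⟩ :=
      (((hF.and hconst).filter_mono nhdsWithin_le_nhds).and
        (self_mem_nhdsWithin : {z}ᶜ ∈ 𝓝[≠] z)).exists
    refine hyz (OnePoint.coe_injective (g.injOn hy1 hx ?_))
    rw [← hy2, hy3, hFz, hv]
  · rw [← hv, OnePoint.nhds_coe_eq, mem_map]
    rw [hFz] at hopen
    refine hopen ?_
    rw [mem_map]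
    filter_upwards [hF] with y hy
    exact ⟨y, hy.1, hy.2.symm⟩

section

variable {E : Set RS}

theorem range_eq_image_of_forall {g : ConfMap} {φ : E → RS} (h : ∀ x : E, φ x = g.toFun ↑x) :
    range φ = g.toFun '' E := by
  rw [funext h]
  exact (image_eq_range g.toFun E).symm

theorem isCompact_range_of_mem_OmegaS (hE : IsAnnular E) {φ : E → RS} (hφ : φ ∈ OmegaS E) :
    IsCompact (range φ) := by
  obtain ⟨g, hEg, -, hg⟩ := hφ
  rw [range_eq_image_of_forall hg]
  exact hE.compact.image_of_continuousOn fun x hx => (g.holo x (hEg hx)).1.continuousWithinAt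

theorem infty_notMem_range_of_mem_OmegaS {φ : E → RS} (hφ : φ ∈ OmegaS E) :
    OnePoint.infty ∉ range φ := by
  obtain ⟨g, -, hs, hg⟩ := hφ
  rw [range_eq_image_of_forall hg]
  exact hs.2.1

theorem compl_alphaSetOf_range (hE : IsAnnular E) {φ : E → RS} (hφ : φ ∈ OmegaS E) :
    (alphaSetOf (range φ))ᶜ = extComp (range φ) := by
  have := locallyConnectedSpace_onePoint_complex
  have hSc : IsCompact (range φ) := isCompact_range_of_mem_OmegaS hE hφ
  have hSo : IsOpen (range φ)ᶜ := hSc.isClosed.isOpen_compl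
  obtain ⟨g, hEg, ⟨-, hinf, hne, hint, hext⟩, hg⟩ := hφ
  have hS := range_eq_image_of_forall hg
  rw [← hS] at hinf hne hint hext
  have himg : ∀ q ∈ g.toFun '' g.dom, q ∉ range φ → q ∈ intComp (range φ) ∪ extComp (range φ) := by
    rintro _ ⟨p, hp, rfl⟩ hq
    have hpE : p ∉ E := fun h => hq (hS ▸ mem_image_of_mem _ h)
    have hpc : p ∈ connectedComponentIn Eᶜ p := mem_connectedComponentIn hpE
    rcases hE.comps p hpE with h | h
    · exact Or.inl (hint ⟨p, ⟨hp, h ▸ hpc⟩, rfl⟩)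
    · exact Or.inr (hext ⟨p, ⟨hp, h ▸ hpc⟩, rfl⟩)
  ext p
  constructor
  · intro hp
    have hpS : p ∉ range φ := fun h => hp (Or.inl h)
    by_contra hpe
    have hpW : p ∈ connectedComponentIn (range φ)ᶜ p := mem_connectedComponentIn hpS
    have hdisj : ∀ q ∈ connectedComponentIn (range φ)ᶜ p, q ∉ g.toFun '' g.dom := by
      intro q hq hqg
      have h1 := connectedComponentIn_eq hq
      rcases himg q hqg (connectedComponentIn_subset _ _ hq) with h2 | h2
      · refine hp (Or.inr ?_)
        rw [intComp, connectedComponentIn_eq h2, ← h1]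
        exact hpW
      · refine hpe ?_
        rw [extComp, connectedComponentIn_eq h2, ← h1]
        exact hpW
    have hcl : ¬ closure (connectedComponentIn (range φ)ᶜ p) ∩ univ ⊆
        connectedComponentIn (range φ)ᶜ p := by
      intro hsub
      have h1 := isPreconnected_univ.subset_of_closure_inter_subset hSo.connectedComponentIn
        ⟨p, trivial, hpW⟩ hsub
      obtain ⟨x, hx⟩ := hE.connected.nonempty
      exact connectedComponentIn_subset _ _ (h1 (mem_univ (φ ⟨x, hx⟩))) (mem_range_self _)
    obtain ⟨q, ⟨hq, -⟩, hqW⟩ := not_subset.mp hcl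
    have hqS : q ∈ range φ := by
      by_contra hqS
      exact hqW (closure_connectedComponentIn_inter_subset _ _ ⟨hq, hqS⟩)
    obtain ⟨x, rfl⟩ := hqS
    have hnhds : g.toFun '' g.dom ∈ 𝓝 (φ x) := by
      rw [hg x]
      refine g.image_dom_mem_nhds (hEg x.2) (fun h => hE.infty_not_mem (h ▸ x.2)) fun h => hinf ?_
      rw [← h, ← hg x]
      exact mem_range_self x
    obtain ⟨y, hy1, hy2⟩ := mem_closure_iff_nhds.mp hq _ hnhds
    exact hdisj y hy2 hy1
  · rintro hp (h | h)
    · exact connectedComponentIn_subset _ _ hp h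
    · exact hne ((connectedComponentIn_eq h).trans (connectedComponentIn_eq hp).symm)

/-- A neighbourhood `A` of `α(Σ)` contains a smaller neighbourhood `B` contained in a compact
subset `K` of the finite part of `A` with connected complement in the sphere. -/
theorem exists_isDomain_subset_compact (hE : IsAnnular E) {φ : E → RS} (hφ : φ ∈ OmegaS E)
    {A : Set RS} (hA : IsOpen A) (hsub : alphaSetOf (range φ) ⊆ A) :
    ∃ (B : Set RS) (K : Set ℂ), IsDomain B ∧ OnePoint.infty ∉ B ∧ alphaSetOf (range φ) ⊆ B ∧
      finitePart B ⊆ K ∧ K ⊆ finitePart A ∧ IsCompact K ∧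
      ∀ z ∉ K, ¬ Bornology.IsBounded (connectedComponentIn Kᶜ z) := by
  have := locallyConnectedSpace_onePoint_complex
  have hext := compl_alphaSetOf_range hE hφ
  have hVo : IsOpen (extComp (range φ)) :=
    (isCompact_range_of_mem_OmegaS hE hφ).isClosed.isOpen_compl.connectedComponentIn
  have hinfV : OnePoint.infty ∈ extComp (range φ) :=
    mem_connectedComponentIn (infty_notMem_range_of_mem_OmegaS hφ)
  obtain ⟨O, hO, hOc, hinfO, hAO, hOV⟩ :=
    hA.isClosed_compl.isCompact.exists_isPreconnected_closure_subset hVo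
      isPreconnected_connectedComponentIn hinfV (hext ▸ compl_subset_compl.mpr hsub)
  have hαB : alphaSetOf (range φ) ⊆ (closure O)ᶜ := by
    rw [subset_compl_comm, hext]
    exact hOV
  have hKcl : IsClosed ((fun z : ℂ => (z : RS)) '' {z : ℂ | (z : RS) ∉ O}) := by
    convert hO.isClosed_compl using 1
    ext q
    constructor
    · rintro ⟨z, hz, rfl⟩
      exact hz
    · intro hq
      obtain ⟨z, rfl⟩ := OnePoint.ne_infty_iff_exists.mp fun h : q = OnePoint.infty =>
        hq (h ▸ hinfO)
      exact ⟨z, hq, rfl⟩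
  have hinfB : OnePoint.infty ∉ (closure O)ᶜ := fun h => h (subset_closure hinfO)
  obtain ⟨x, hx⟩ := hE.connected.nonempty
  exact ⟨(closure O)ᶜ, {z : ℂ | (z : RS) ∉ O},
    ⟨isClosed_closure.isOpen_compl, ⟨φ ⟨x, hx⟩, hαB (Or.inl (mem_range_self _))⟩,
      fun h => hinfB (h ▸ mem_univ _)⟩,
    hinfB, hαB, fun z hz hzO => hz (subset_closure hzO),
    fun z hz => by_contra fun h => hz (hAO h), (OnePoint.isClosed_image_coe.mp hKcl).2,
    fun z hz => not_isBounded_connectedComponentIn_of_isPreconnected hO hOc hinfO rfl hz⟩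

end

end CFT

/-- Locally uniform convergence of holomorphic functions passes to iterated derivatives. -/
theorem TendstoLocallyUniformlyOn.tendsto_iteratedDeriv {U : Set ℂ} (hU : IsOpen U)
    {F : ℕ → ℂ → ℂ} {h : ℂ → ℂ} (hF : ∀ n, DifferentiableOn ℂ (F n) U)
    (hlim : TendstoLocallyUniformlyOn F h atTop U) {w : ℂ} (hw : w ∈ U) (k : ℕ) :
    Tendsto (fun n => iteratedDeriv k (F n) w) atTop (𝓝 (iteratedDeriv k h w)) := by
  have key : ∀ k : ℕ, (∀ n, DifferentiableOn ℂ (iteratedDeriv k (F n)) U) ∧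
      TendstoLocallyUniformlyOn (fun n => iteratedDeriv k (F n)) (iteratedDeriv k h) atTop U := by
    intro k
    induction k with
    | zero => simpa only [iteratedDeriv_zero] using ⟨hF, hlim⟩
    | succ k ih =>
      simp only [iteratedDeriv_succ]
      exact ⟨fun n => (ih.1 n).deriv hU, ih.2.deriv (Eventually.of_forall ih.1) hU⟩
  exact (key k).2.tendsto_at hw

theorem Polynomial.coeff_taylor_eq_iteratedDeriv_div (p : Polynomial ℂ) (w : ℂ) (k : ℕ) :
    (Polynomial.taylor w p).coeff k =
      iteratedDeriv k (fun z => p.eval z) w / (k.factorial : ℂ) := by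
  have h1 : ∀ k : ℕ, iteratedDeriv k (fun z => p.eval z) =
      fun z => (Polynomial.derivative^[k] p).eval z := by
    intro k
    induction k with
    | zero => simp
    | succ k ih =>
      rw [iteratedDeriv_succ, ih, Function.iterate_succ_apply']
      funext z
      rw [Polynomial.deriv]
  have h2 : (k.factorial : ℂ) ≠ 0 := Nat.cast_ne_zero.mpr k.factorial_ne_zero
  rw [Polynomial.taylor_coeff, h1, eq_div_iff h2]
  rw [← Polynomial.factorial_smul_hasseDeriv, LinearMap.smul_apply, nsmul_eq_mul]
  exact (mul_comm _ _).trans Polynomial.eval_natCast_mul.symm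

namespace CFT

theorem mem_HVFset_iff_of_infty_notMem {B : Set RS} (hB : OnePoint.infty ∉ B) {g : ℂ → ℂ} :
    g ∈ HVFset B ↔ DifferentiableOn ℂ g (finitePart B) :=
  and_iff_left fun h => absurd h hB

section

variable {E : Set RS} {X : ExhChoice} {D : (ℂ → ℂ) → ((E → RS) → ℂ) → (E → RS) → ℂ}

/-- On a domain `B`, the conformal derivative of a differentiable function is an additive,
real-homogeneous and continuous functional of the direction. -/
theorem exists_functional_of_diffAt (hD : IsNablaOp E X D) {f : (E → RS) → ℂ} {φ : E → RS}
    (hdiff : DiffAt E X f φ) {B : Set RS} (hB : IsDomain B) (hsub : range φ ⊆ B) :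
    ∃ ℓ : (ℂ → ℂ) → ℂ, (∀ g ∈ HVFset B, D g f φ = ℓ g) ∧
      (∀ g ∈ HVFset B, ∀ g' ∈ HVFset B, ℓ (g + g') = ℓ g + ℓ g') ∧
      (∀ g ∈ HVFset B, ∀ c : ℝ, ℓ (c • g) = c • ℓ g) ∧
      ∀ (gs : ℕ → ℂ → ℂ) (g : ℂ → ℂ), (∀ n, gs n ∈ HVFset B) → g ∈ HVFset B →
        HVFTendsto B atTop gs g → Tendsto (fun n => ℓ (gs n)) atTop (𝓝 (ℓ g)) := by
  obtain ⟨⟨L, hL⟩, -⟩ := hdiff B hB hsub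
  have hupd : ∀ g g' : ℂ → ℂ, Function.update (fun _ : Fin (0 + 1) => g) 0 g' = fun _ => g' :=
    fun g g' => funext fun i => by rw [show i = 0 from Fin.fin_one_eq_zero i, Function.update_self]
  refine ⟨fun g => L fun _ => g, fun g hg => ?_, fun g hg g' hg' => ?_, fun g hg c => ?_,
    fun gs g hgs hg hlim => ?_⟩
  · exact hD f φ B hB (0 + 1) L (fun _ => g) Nat.one_pos (fun _ => hg) hL
  · have h1 := hL.1.1 (fun _ => g) 0 g' (fun _ => hg) hg'
    simpa only [hupd] using h1
  · have h1 := hL.1.2.1 (fun _ => g) 0 c fun _ => hg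
    simpa only [hupd] using h1
  · exact hL.1.2.2 (fun n _ => gs n) (fun _ => g) (fun n _ => hgs n) (fun _ => hg) fun _ => hlim

/-- On a domain `B` of the plane, the holomorphic derivative is a complex linear and continuous
functional of the direction. -/
theorem Dh_linear_of_diffAt (hD : IsNablaOp E X D) {f : (E → RS) → ℂ} {φ : E → RS}
    (hdiff : DiffAt E X f φ) {B : Set RS} (hB : IsDomain B) (hinf : OnePoint.infty ∉ B)
    (hsub : range φ ⊆ B) :
    (∀ g g' : ℂ → ℂ, DifferentiableOn ℂ g (finitePart B) → DifferentiableOn ℂ g' (finitePart B) →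
      Dh E D (g + g') f φ = Dh E D g f φ + Dh E D g' f φ) ∧
    (∀ (c : ℂ) (g : ℂ → ℂ), DifferentiableOn ℂ g (finitePart B) →
      Dh E D (c • g) f φ = c * Dh E D g f φ) ∧
    ∀ (gs : ℕ → ℂ → ℂ) (g : ℂ → ℂ), (∀ n, DifferentiableOn ℂ (gs n) (finitePart B)) →
      DifferentiableOn ℂ g (finitePart B) →
      TendstoLocallyUniformlyOn gs g atTop (finitePart B) →
      Tendsto (fun n => Dh E D (gs n) f φ) atTop (𝓝 (Dh E D g f φ)) := by
  obtain ⟨ℓ, hℓ, hadd, hsmul, hlim⟩ := exists_functional_of_diffAt hD hdiff hB hsub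
  simp only [mem_HVFset_iff_of_infty_notMem hinf] at hℓ hadd hsmul hlim
  have hDh : ∀ g : ℂ → ℂ, DifferentiableOn ℂ g (finitePart B) →
      Dh E D g f φ = (1 / 2 : ℂ) * (ℓ g - Complex.I * ℓ (Complex.I • g)) := fun g hg => by
    rw [← hℓ g hg, ← hℓ _ (hg.const_smul Complex.I)]
    rfl
  refine ⟨fun g g' hg hg' => ?_, fun c g hg => ?_, fun gs g hgs hg ht => ?_⟩
  · rw [hDh _ (hg.add hg'), hDh g hg, hDh g' hg', smul_add, hadd g hg g' hg',
      hadd _ (hg.const_smul _) _ (hg'.const_smul _)]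
    ring
  · have hIg := hg.const_smul Complex.I
    have hc : c • g = c.re • g + c.im • (Complex.I • g) := by
      funext z
      simp only [Pi.add_apply, Pi.smul_apply, smul_eq_mul, Complex.real_smul]
      nth_rewrite 1 [← Complex.re_add_im c]
      ring
    have hIc : Complex.I • (c • g) = c.re • (Complex.I • g) + (-c.im) • g := by
      funext z
      simp only [Pi.add_apply, Pi.smul_apply, smul_eq_mul, Complex.real_smul]
      nth_rewrite 1 [← Complex.re_add_im c]
      push_cast
      linear_combination (c.im * g z) * Complex.I_mul_I
    rw [hDh _ (hg.const_smul c), hDh g hg, hIc, hc,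
      hadd _ (hg.const_smul c.re) _ (hIg.const_smul c.im),
      hadd _ (hIg.const_smul c.re) _ (hg.const_smul (-c.im)),
      hsmul g hg, hsmul g hg, hsmul _ hIg, hsmul _ hIg]
    simp only [Complex.real_smul]
    push_cast
    linear_combination (1 / 2 * c.im * ℓ (Complex.I • g)) * Complex.I_mul_I +
      (1 / 2 * (ℓ g - Complex.I * ℓ (Complex.I • g))) * Complex.re_add_im c
  · have hI : TendstoLocallyUniformlyOn (fun n => Complex.I • gs n) (Complex.I • g) atTop
        (finitePart B) :=
      (uniformContinuous_const_smul Complex.I).comp_tendstoLocallyUniformlyOn ht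
    have h1 := hlim gs g hgs hg ⟨ht, fun h => absurd h hinf⟩
    have h2 := hlim _ _ (fun n => (hgs n).const_smul Complex.I) (hg.const_smul Complex.I)
      ⟨hI, fun h => absurd h hinf⟩
    rw [hDh g hg]
    simp only [hDh _ (hgs _)]
    exact (h1.sub (h2.const_mul _)).const_mul _

/-- The expansion of the holomorphic derivative along a polynomial vector field. -/
theorem Dh_polynomial_eval (hD : IsNablaOp E X D) {f : (E → RS) → ℂ} {φ : E → RS}
    (hdiff : DiffAt E X f φ) {B : Set RS} (hB : IsDomain B) (hinf : OnePoint.infty ∉ B)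
    (hsub : range φ ⊆ B) (w : ℂ) (p : Polynomial ℂ) {F : Finset ℕ}
    (hF : ∀ k : ℕ, k ∉ F → Dh E D (hvf (k - 1) w) f φ = 0) :
    Dh E D (fun z => p.eval z) f φ =
      ∑ k ∈ F, (-1 : ℂ) ^ k / (k.factorial : ℂ) * iteratedDeriv k (fun z => p.eval z) w *
        Dh E D (hvf (k - 1) w) f φ := by
  obtain ⟨hadd, hsmul, -⟩ := Dh_linear_of_diffAt hD hdiff hB hinf hsub
  have hp : ∀ p : Polynomial ℂ, DifferentiableOn ℂ (fun z => p.eval z) (finitePart B) :=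
    fun p => p.differentiable.differentiableOn
  let T : Polynomial ℂ →ₗ[ℂ] ℂ :=
    { toFun := fun p => Dh E D (fun z => p.eval z) f φ
      map_add' := fun p q => by
        rw [← hadd _ _ (hp p) (hp q)]
        simp only [Polynomial.eval_add]
        rfl
      map_smul' := fun c p => by
        rw [RingHom.id_apply, smul_eq_mul, ← hsmul c _ (hp p)]
        simp only [Polynomial.eval_smul]
        rfl }
  have hT : ∀ k : ℕ, T ((Polynomial.X - Polynomial.C w) ^ k) =
      (-1) ^ k * Dh E D (hvf (k - 1) w) f φ := fun k => by
    have h1 : hvf (k - 1) w = fun z => ((Polynomial.C w - Polynomial.X) ^ k).eval z := by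
      funext z
      simp [hvf]
    rw [h1, ← hsmul _ _ (hp _)]
    change Dh E D _ f φ = _
    congr 1
    funext z
    simp only [Polynomial.eval_pow, Polynomial.eval_sub, Polynomial.eval_X, Polynomial.eval_C,
      Pi.smul_apply, smul_eq_mul, ← mul_pow]
    ring
  have hsum : T p = ∑ k ∈ (Polynomial.taylor w p).support ∪ F,
      (-1 : ℂ) ^ k / (k.factorial : ℂ) * iteratedDeriv k (fun z => p.eval z) w *
        Dh E D (hvf (k - 1) w) f φ := by
    conv_lhs => rw [← Polynomial.sum_taylor_eq p w]
    rw [Polynomial.sum_def, map_sum]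
    refine Finset.sum_subset_zero_on_sdiff Finset.subset_union_left (fun k hk => ?_) fun k _ => ?_
    · have h1 := Polynomial.notMem_support_iff.mp (Finset.mem_sdiff.mp hk).2
      rw [Polynomial.coeff_taylor_eq_iteratedDeriv_div] at h1
      linear_combination ((-1 : ℂ) ^ k * Dh E D (hvf (k - 1) w) f φ) * h1
    · rw [← Polynomial.smul_eq_C_mul, map_smul, hT, smul_eq_mul,
        Polynomial.coeff_taylor_eq_iteratedDeriv_div]
      ring
  refine hsum.trans (Finset.sum_subset Finset.subset_union_right fun k _ hk => ?_).symm
  rw [hF k hk, mul_zero]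

end

end CFT

open CFT Set in
/-- Lemma 2.20 of the paper: if `f` is differentiable at `Σ`, `h` is a
holomorphic vector field on a simply connected domain `A ⊃ α(Σ)`, `w ∈ α(Σ)`, and
`Δ[h_{n;w}] f(Σ) = 0` for all but finitely many `n ≥ −1`, then
`Δ[h] f(Σ) = ∑_{n≥−1} ((−1)^{n+1}/(n+1)!) ∂^{n+1}h(w) Δ[h_{n;w}] f(Σ)`. -/
theorem expansion_in_hnw
    (E : Set RS) (hE : IsAnnular E) (X : ExhChoice)
    (D : (ℂ → ℂ) → ((E → RS) → ℂ) → (E → RS) → ℂ) (hD : IsNablaOp E X D)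
    (N : Set (E → RS)) (hN : ConfOpen E X N)
    (f : (E → RS) → ℂ) (φ : E → RS) (hφ : φ ∈ N)
    (hdiff : DiffAt E X f φ)
    (A : Set RS) (hA : IsDomain A) (hsc : SimplyConnectedSpace ↥A)
    (hsubα : alphaSetOf (Set.range φ) ⊆ A)
    (h : ℂ → ℂ) (hh : h ∈ HVFset A)
    (w : ℂ) (hw : ((w : ℂ) : RS) ∈ alphaSetOf (Set.range φ))
    (hfin : {n : ℤ | -1 ≤ n ∧ Dh E D (hvf n w) f φ ≠ 0}.Finite) :
    Dh E D h f φ =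
      ∑ᶠ n : ℤ, if -1 ≤ n then
        ((-1 : ℂ) ^ ((n + 1).toNat) / (((n + 1).toNat.factorial : ℕ) : ℂ)) *
          iteratedDeriv ((n + 1).toNat) h w * Dh E D (hvf n w) f φ
      else 0 := by
  have hφΩ : φ ∈ OmegaS E := hN.1 hφ
  obtain ⟨B, K, hB, hinf, hαB, hBK, hKA, hK, hunb⟩ :=
    exists_isDomain_subset_compact hE hφΩ hA.1 hsubα
  have hrB : range φ ⊆ B := fun _ hx => hαB (Or.inl hx)
  have hAo : IsOpen (finitePart A) := hA.1.preimage OnePoint.continuous_coe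
  have hBo : IsOpen (finitePart B) := hB.1.preimage OnePoint.continuous_coe
  have hwB : w ∈ finitePart B := hαB hw
  obtain ⟨p, hp⟩ := exists_polynomial_tendstoUniformlyOn hK hAo hKA hh.1 hunb
  have hlim : TendstoLocallyUniformlyOn (fun n z => (p n).eval z) h atTop (finitePart B) :=
    (hp.mono hBK).tendstoLocallyUniformlyOn
  have hpd : ∀ n, DifferentiableOn ℂ (fun z => (p n).eval z) (finitePart B) :=
    fun n => (p n).differentiable.differentiableOn
  have hT := (Dh_linear_of_diffAt hD hdiff hB hinf hrB).2.2 _ h hpd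
    (hh.1.mono (hBK.trans hKA)) hlim
  obtain ⟨F, hFmem⟩ : ∃ F : Finset ℕ, ∀ n : ℤ, -1 ≤ n → Dh E D (hvf n w) f φ ≠ 0 →
      (n + 1).toNat ∈ F :=
    ⟨hfin.toFinset.image fun n => (n + 1).toNat, fun n h1 h2 =>
      Finset.mem_image.mpr ⟨n, hfin.mem_toFinset.mpr ⟨h1, h2⟩, rfl⟩⟩
  have hF : ∀ k : ℕ, k ∉ F → Dh E D (hvf (k - 1) w) f φ = 0 := fun k hk => by
    by_contra hne
    exact hk (by simpa using hFmem ((k : ℤ) - 1) (by omega) hne)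
  simp only [Dh_polynomial_eval hD hdiff hB hinf hrB w _ hF] at hT
  have hS := tendsto_finsetSum F fun k _ =>
    ((hlim.tendsto_iteratedDeriv hBo hpd hwB k).const_mul
      ((-1 : ℂ) ^ k / (k.factorial : ℂ))).mul_const (Dh E D (hvf (k - 1) w) f φ)
  rw [tendsto_nhds_unique hT hS,
    finsum_eq_sum_of_support_subset (s := F.image fun k : ℕ => (k : ℤ) - 1)]
  · rw [Finset.sum_image fun a _ b _ hab => by simpa using hab]
    exact Finset.sum_congr rfl fun k _ => by
      rw [if_pos (by omega), sub_add_cancel, Int.toNat_natCast]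
  · intro n hn
    rw [Function.mem_support] at hn
    split_ifs at hn with h1
    · exact Finset.mem_coe.mpr (Finset.mem_image.mpr
        ⟨(n + 1).toNat, hFmem n h1 (right_ne_zero_of_mul hn), by omega⟩)
    · exact absurd rfl hn
end
end
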